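/- arXiv:1112.5087 — 2 statements merged into one kernel-verified Lean document; each statement's English description precedes it below -/
import Mathlib

section
/- Let μ be a Borel probability measure on ℝ, not a Dirac measure, with m_8(μ) < ∞, m_1(μ) = 0 and m_2(μ) = 1. Then there exist constants c₁(μ) > 0, c(μ) > 0 and n₁ = n₁(μ) ∈ ℕ such that, with I_n = {x ∈ ℝ : |x − a_n| ≤ 2/e_n − c₁(μ) n^{−6/5}}, for all n ≥ n₁ and all x ∈ I_n: p_n(x) = p_n*(x) + θ(x) c(μ) / ( n^{6/5} √(4 − (e_n(x−a_n))²) ) + ρ_n(x), where |θ(x)| ≤ 1 and ρ_n is a continuous function with 0 ≤ ρ_n(x) ≤ c(μ) on I_n and ∫_{I_n} ρ_n(x) dx ≤ c(μ) n^{−4}. -/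
open MeasureTheory Complex Filter Set
open scoped Topology

noncomputable section

namespace FreeCLT

def mom (μ : Measure ℝ) (k : ℕ) : ℝ := ∫ u, u ^ k ∂μ

def cauchy (μ : Measure ℝ) (z : ℂ) : ℂ := ∫ u, (z - (u : ℂ))⁻¹ ∂μ

def recip (μ : Measure ℝ) (z : ℂ) : ℂ := (cauchy μ z)⁻¹

def MemF (F : ℂ → ℂ) : Prop :=
  ∃ ν : Measure ℝ, IsProbabilityMeasure ν ∧ ∀ z : ℂ, 0 < z.im → F z = recip ν z

def Subord (μ : Measure ℝ) (n : ℕ) (Z : ℂ → ℂ) : Prop :=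
  MemF Z ∧ ∀ z : ℂ, 0 < z.im →
    z = (n : ℂ) * Z z - ((n : ℂ) - 1) * recip μ (Z z)

def IsBoxPow (μ : Measure ℝ) (n : ℕ) (Z : ℂ → ℂ) (ν : Measure ℝ) : Prop :=
  Subord μ n Z ∧ IsProbabilityMeasure ν ∧
    ∀ z : ℂ, 0 < z.im → recip ν z = recip μ (Z z)

def rescale (n : ℕ) (ν : Measure ℝ) : Measure ℝ :=
  ν.map (fun x => x / Real.sqrt n)

def HasDensity (ν : Measure ℝ) (p : ℝ → ℝ) : Prop :=
  Continuous p ∧ (∀ x, 0 ≤ p x) ∧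
    ν = MeasureTheory.volume.withDensity (fun x => ENNReal.ofReal (p x))

def aQ (μ : Measure ℝ) (n : ℕ) : ℝ := mom μ 3 / Real.sqrt n
def bQ (μ : Measure ℝ) (n : ℕ) : ℝ := (mom μ 4 - (mom μ 3) ^ 2 - 1) / n
def dQ (μ : Measure ℝ) (n : ℕ) : ℝ := (mom μ 4 - (mom μ 3) ^ 2) / n
def eQ (μ : Measure ℝ) (n : ℕ) : ℝ := (1 - bQ μ n) / Real.sqrt (1 - dQ μ n)

def pw (x : ℝ) : ℝ := (1 / (2 * Real.pi)) * Real.sqrt (max (4 - x ^ 2) 0)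

def truncSet (n : ℕ) : Set ℝ := {u : ℝ | |u| ≤ Real.sqrt ((n : ℝ) - 1) / Real.pi}

def Tfun (W : ℕ → ℂ → ℂ) (n : ℕ) (z : ℂ) : ℂ :=
  W n ((Real.sqrt (n : ℝ) : ℂ) * z) / (Real.sqrt (n : ℝ) : ℂ)



def st (m : Measure ℝ) (f : ℝ → ℝ) (z : ℂ) : ℂ := ∫ u, (f u : ℂ) * (z - (u : ℂ))⁻¹ ∂m

theorem sub_ne (z : ℂ) (hz : 0 < z.im) (u : ℝ) : z - (u : ℂ) ≠ 0 := by
  intro h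
  have := congrArg Complex.im h
  simp at this
  linarith

theorem norm_inv_le (z : ℂ) (hz : 0 < z.im) (u : ℝ) : ‖(z - (u : ℂ))⁻¹‖ ≤ 1 / z.im := by
  rw [norm_inv, ← one_div]
  apply one_div_le_one_div_of_le hz
  have := Complex.abs_im_le_norm (z - u)
  simp at this
  exact (le_abs_self _).trans this

theorem st_meas (m : Measure ℝ) (z : ℂ) :
    AEStronglyMeasurable (fun u : ℝ => (z - (u : ℂ))⁻¹) m := by
  apply Measurable.aestronglyMeasurable
  fun_prop

theorem st_int {m : Measure ℝ} {f : ℝ → ℝ} (hf : Integrable f m) {z : ℂ} (hz : 0 < z.im) :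
    Integrable (fun u : ℝ => (f u : ℂ) * (z - (u : ℂ))⁻¹) m :=
  hf.ofReal.mul_bdd (c := 1 / z.im) (st_meas m z) (Eventually.of_forall (norm_inv_le z hz))

theorem st_mul {m : Measure ℝ} {f : ℝ → ℝ} (hf : Integrable f m)
    (hf' : Integrable (fun u => f u * u) m) {z : ℂ} (hz : 0 < z.im) :
    z * st m f z = ((∫ u, f u ∂m : ℝ) : ℂ) + st m (fun u => f u * u) z := by
  unfold st
  rw [← integral_const_mul, ← integral_complex_ofReal]
  refine Eq.trans ?_ (integral_add hf.ofReal (st_int hf' hz))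
  congr 1
  ext u
  have := sub_ne z hz u
  field_simp
  push_cast
  ring

theorem st_bound {m : Measure ℝ} (f : ℝ → ℝ) {z : ℂ} (hz : 0 < z.im) (hf : Integrable f m) :
    ‖st m f z‖ ≤ (∫ u, |f u| ∂m) / z.im := by
  unfold st
  rw [div_eq_mul_one_div, ← integral_mul_const]
  apply norm_integral_le_of_norm_le (hf.abs.mul_const _)
  filter_upwards with u
  rw [norm_mul, Complex.norm_real, Real.norm_eq_abs]
  exact mul_le_mul_of_nonneg_left (norm_inv_le z hz u) (abs_nonneg _)


theorem re_ker (y : ℝ) (hy : 0 < y) (u c : ℝ) :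
    (((y : ℂ) * I) * ((c : ℂ) * ((y : ℂ) * I - (u : ℂ))⁻¹)).re = c * (y ^ 2 / (y ^ 2 + u ^ 2)) := by
  have h : Complex.normSq ((y : ℂ) * I - (u : ℂ)) = y ^ 2 + u ^ 2 := by
    simp [Complex.normSq_apply]; ring
  simp only [Complex.mul_re, Complex.mul_im, Complex.inv_re, Complex.inv_im, h]
  simp
  field_simp

theorem step (m : Measure ℝ) (f : ℝ → ℝ) (hf0 : ∀ u, 0 ≤ f u) (hfc : Continuous f)
    (hf : Integrable f m) (α0 α1 : ℝ) (H : ℝ → ℂ) (C Y : ℝ) (hY : 0 < Y)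
    (hH : ∀ y, Y ≤ y → ((y : ℂ) * I) ^ 2 * st m f ((y : ℂ) * I) = α0 * ((y : ℂ) * I) + α1 + H y)
    (hb : ∀ y, Y ≤ y → ‖H y‖ ≤ C / y) :
    Integrable (fun u => f u * u ^ 2) m ∧ Integrable (fun u => f u * u) m ∧
    α0 = ∫ u, f u ∂m ∧ α1 = ∫ u, f u * u ∂m ∧
    ∀ y, Y ≤ y → H y = st m (fun u => f u * u ^ 2) ((y : ℂ) * I) := by
  have hC : 0 ≤ C := by
    have := (norm_nonneg _).trans (hb Y le_rfl)
    rw [le_div_iff₀ hY] at this; linarith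
  have him : ∀ y : ℝ, Y ≤ y → 0 < ((y : ℂ) * I).im := by
    intro y hy; simp; linarith
  have hA : ∀ y, Y ≤ y → ∫ u, f u * (y ^ 2 / (y ^ 2 + u ^ 2)) ∂m = α0 + (H y / ((y : ℂ) * I)).re := by
    intro y hy
    have hy0 : 0 < y := hY.trans_le hy
    have hy1 : (y : ℂ) * I ≠ 0 := by simp [hy0.ne']
    have e1 : ((y : ℂ) * I) * st m f ((y : ℂ) * I) = α0 + α1 / ((y : ℂ) * I) + H y / ((y : ℂ) * I) := by
      have h3 := hH y hy
      generalize (y : ℂ) * I = w at h3 hy1 ⊢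
      field_simp
      linear_combination h3
    have e2 := congrArg Complex.re e1
    unfold st at e2
    rw [← integral_const_mul] at e2
    have e3 := reCLM.integral_comp_comm ((st_int hf (him y hy)).const_mul ((y : ℂ) * I))
    simp only [reCLM_apply] at e3
    rw [← e3] at e2
    simp only [re_ker y hy0] at e2
    rw [e2]
    simp only [Complex.add_re, Complex.ofReal_re]
    have : ((α1 : ℂ) / ((y : ℂ) * I)).re = 0 := by
      simp [Complex.div_re]
    rw [this, add_zero]
  have hre : ∀ y, Y ≤ y → |(H y / ((y : ℂ) * I)).re| ≤ C / y ^ 2 := by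
    intro y hy
    have hy0 : 0 < y := hY.trans_le hy
    refine (Complex.abs_re_le_norm _).trans ?_
    rw [norm_div]
    have : ‖(y : ℂ) * I‖ = y := by simp [abs_of_pos hy0]
    rw [this, pow_two, ← div_div]
    exact div_le_div_of_nonneg_right (hb y hy) hy0.le
  have hratio : ∀ y : ℝ, 0 < y → ∀ u : ℝ, 0 ≤ y ^ 2 / (y ^ 2 + u ^ 2) ∧ y ^ 2 / (y ^ 2 + u ^ 2) ≤ 1 := by
    intro y hy u
    refine ⟨by positivity, ?_⟩
    rw [div_le_one (by positivity)]
    nlinarith [sq_nonneg u]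
  have hlimr : ∀ u : ℝ, Tendsto (fun y : ℝ => y ^ 2 / (y ^ 2 + u ^ 2)) atTop (𝓝 1) := by
    intro u
    have h1 : Tendsto (fun y : ℝ => 1 - u ^ 2 / (y ^ 2 + u ^ 2)) atTop (𝓝 (1 - 0)) := by
      apply Tendsto.const_sub
      apply Tendsto.const_div_atTop
      apply tendsto_atTop_add_const_right
      exact tendsto_pow_atTop (by norm_num)
    rw [sub_zero] at h1
    refine h1.congr' ?_
    filter_upwards [eventually_gt_atTop 0] with y hy
    field_simp
    ring
  have hmeas : ∀ y : ℝ, 0 < y → AEStronglyMeasurable (fun u => f u * (y ^ 2 / (y ^ 2 + u ^ 2))) m := by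
    intro y hy
    have : Measurable f := hfc.measurable
    exact Measurable.aestronglyMeasurable (by fun_prop)
  have hI : ∀ y : ℝ, 0 < y → Integrable (fun u => f u * (y ^ 2 / (y ^ 2 + u ^ 2))) m := by
    intro y hy
    refine hf.mono' (hmeas y hy) ?_
    filter_upwards with u
    rw [Real.norm_eq_abs, abs_of_nonneg (mul_nonneg (hf0 u) (hratio y hy u).1)]
    exact mul_le_of_le_one_right (hf0 u) (hratio y hy u).2
  have hz2 : Tendsto (fun y : ℝ => C / y ^ 2) atTop (𝓝 0) :=
    Tendsto.const_div_atTop (tendsto_pow_atTop (by norm_num)) C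
  have hz1 : ∀ D : ℝ, Tendsto (fun y : ℝ => D / y) atTop (𝓝 0) := fun D =>
    Tendsto.const_div_atTop tendsto_id D
  have hα0 : α0 = ∫ u, f u ∂m := by
    have t1 : Tendsto (fun y : ℝ => ∫ u, f u * (y ^ 2 / (y ^ 2 + u ^ 2)) ∂m) atTop (𝓝 (∫ u, f u ∂m)) := by
      apply tendsto_integral_filter_of_dominated_convergence f
      · filter_upwards [eventually_gt_atTop 0] with y hy using hmeas y hy
      · filter_upwards [eventually_gt_atTop 0] with y hy
        filter_upwards with u
        rw [Real.norm_eq_abs, abs_of_nonneg (mul_nonneg (hf0 u) (hratio y hy u).1)]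
        exact mul_le_of_le_one_right (hf0 u) (hratio y hy u).2
      · exact hf
      · filter_upwards with u
        simpa using (hlimr u).const_mul (f u)
    have t2 : Tendsto (fun y : ℝ => ∫ u, f u * (y ^ 2 / (y ^ 2 + u ^ 2)) ∂m) atTop (𝓝 (α0 + 0)) := by
      have t3 : Tendsto (fun y : ℝ => (H y / ((y : ℂ) * I)).re) atTop (𝓝 0) := by
        apply squeeze_zero_norm' _ hz2
        filter_upwards [eventually_ge_atTop Y] with y hy using hre y hy
      refine (t3.const_add α0).congr' ?_
      filter_upwards [eventually_ge_atTop Y] with y hy using (hA y hy).symm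
    rw [add_zero] at t2
    exact tendsto_nhds_unique t2 t1
  have hI2 : Integrable (fun u => f u * u ^ 2) m := by
    have hk : ∀ y, Y ≤ y → ∫ u, f u * u ^ 2 * (y ^ 2 / (y ^ 2 + u ^ 2)) ∂m ≤ C := by
      intro y hy
      have hy0 : 0 < y := hY.trans_le hy
      have : ∫ u, f u * u ^ 2 * (y ^ 2 / (y ^ 2 + u ^ 2)) ∂m
          = y ^ 2 * (∫ u, f u ∂m - ∫ u, f u * (y ^ 2 / (y ^ 2 + u ^ 2)) ∂m) := by
        rw [← integral_sub hf (hI y hy0), ← integral_const_mul]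
        congr 1; ext u
        field_simp
        ring
      rw [this, ← hα0, hA y hy]
      have h1 := (abs_le.1 (hre y hy)).1
      have h2 : y ^ 2 * (C / y ^ 2) = C := by field_simp
      nlinarith [sq_nonneg y]
    have hlim : ∀ᵐ u ∂m, Tendsto (fun y : ℝ => f u * u ^ 2 * (y ^ 2 / (y ^ 2 + u ^ 2))) atTop
        (𝓝 (f u * u ^ 2)) := by
      filter_upwards with u
      simpa using (hlimr u).const_mul (f u * u ^ 2)
    have hfm : Measurable f := hfc.measurable
    refine ⟨Measurable.aestronglyMeasurable (by fun_prop), ?_⟩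
    have hnn : ∀ y : ℝ, Y ≤ y → ∀ u, 0 ≤ f u * u ^ 2 * (y ^ 2 / (y ^ 2 + u ^ 2)) := fun y hy u =>
      mul_nonneg (mul_nonneg (hf0 u) (sq_nonneg u)) (hratio y (hY.trans_le hy) u).1
    have hlim2 : ∀ᵐ u ∂m, Tendsto (fun k : ℕ => ENNReal.ofReal (f u * u ^ 2 * ((Y + k) ^ 2 / ((Y + k) ^ 2 + u ^ 2)))) atTop
        (𝓝 (ENNReal.ofReal (f u * u ^ 2))) := by
      filter_upwards [hlim] with u hu
      have : Tendsto (fun k : ℕ => Y + (k : ℝ)) atTop atTop :=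
        tendsto_atTop_add_const_left _ _ tendsto_natCast_atTop_atTop
      exact (ENNReal.continuous_ofReal.tendsto _).comp (hu.comp this)
    rw [hasFiniteIntegral_iff_ofReal (Eventually.of_forall fun u => mul_nonneg (hf0 u) (sq_nonneg u))]
    have key : ∫⁻ u, ENNReal.ofReal (f u * u ^ 2) ∂m ≤ ENNReal.ofReal C := by
      calc ∫⁻ u, ENNReal.ofReal (f u * u ^ 2) ∂m
          = ∫⁻ u, liminf (fun k : ℕ => ENNReal.ofReal (f u * u ^ 2 * ((Y + k) ^ 2 / ((Y + k) ^ 2 + u ^ 2)))) atTop ∂m := by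
            apply lintegral_congr_ae
            filter_upwards [hlim2] with u hu using hu.liminf_eq.symm
        _ ≤ liminf (fun k : ℕ => ∫⁻ u, ENNReal.ofReal (f u * u ^ 2 * ((Y + k) ^ 2 / ((Y + k) ^ 2 + u ^ 2))) ∂m) atTop := by
            apply lintegral_liminf_le
            intro k
            fun_prop
        _ ≤ ENNReal.ofReal C := by
            apply liminf_le_of_frequently_le'
            apply Frequently.of_forall
            intro k
            have hk0 : Y ≤ Y + (k : ℝ) := by simp
            have hy0 : 0 < Y + (k : ℝ) := hY.trans_le hk0
            rw [← ofReal_integral_eq_lintegral_ofReal _ (Eventually.of_forall (hnn _ hk0))]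
            · exact ENNReal.ofReal_le_ofReal (hk _ hk0)
            · refine (hf.mul_const ((Y + k) ^ 2)).mono' (Measurable.aestronglyMeasurable (by fun_prop)) ?_
              filter_upwards with u
              rw [Real.norm_eq_abs, abs_of_nonneg (hnn _ hk0 u), mul_assoc]
              apply mul_le_mul_of_nonneg_left _ (hf0 u)
              rw [mul_div_assoc', div_le_iff₀ (by positivity)]
              nlinarith [sq_nonneg ((Y + k) ^ 2)]
    exact key.trans_lt ENNReal.ofReal_lt_top
  have hI1 : Integrable (fun u => f u * u) m := by
    have hfm : Measurable f := hfc.measurable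
    refine (hf.add hI2).mono' (Measurable.aestronglyMeasurable (by fun_prop)) ?_
    filter_upwards with u
    rw [Real.norm_eq_abs, abs_mul, abs_of_nonneg (hf0 u)]
    show f u * |u| ≤ f u + f u * u ^ 2
    have : |u| ≤ 1 + u ^ 2 := by rw [← sq_abs u]; nlinarith [sq_nonneg (|u| - 1), abs_nonneg u]
    nlinarith [hf0 u]
  have hHe : ∀ y, Y ≤ y → H y = (((∫ u, f u * u ∂m) - α1 : ℝ) : ℂ) + st m (fun u => f u * u ^ 2) ((y : ℂ) * I) := by
    intro y hy
    have e1 := st_mul hf hI1 (him y hy)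
    have hI2' : Integrable (fun u => f u * u * u) m := by
      convert hI2 using 2; ring
    have e2 := st_mul hI1 hI2' (him y hy)
    have e3 : st m (fun u => f u * u * u) ((y : ℂ) * I) = st m (fun u => f u * u ^ 2) ((y : ℂ) * I) := by
      congr 1; ext u; ring
    have e4 := hH y hy
    rw [← hα0] at e1
    rw [e3] at e2
    push_cast
    rw [pow_two, mul_assoc, e1, mul_add, e2] at e4
    linear_combination - e4
  have hα1 : α1 = ∫ u, f u * u ∂m := by
    have t1 : Tendsto (fun y : ℝ => H y - st m (fun u => f u * u ^ 2) ((y : ℂ) * I)) atTop (𝓝 0) := by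
      have : Tendsto (fun y : ℝ => C / y + (∫ u, |f u * u ^ 2| ∂m) / y) atTop (𝓝 0) := by
        have h4 := (hz1 C).add (hz1 (∫ u, |f u * u ^ 2| ∂m))
        rwa [add_zero] at h4
      apply squeeze_zero_norm' _ this
      filter_upwards [eventually_ge_atTop Y] with y hy
      refine (norm_sub_le _ _).trans (add_le_add (hb y hy) ?_)
      simpa using st_bound _ (him y hy) hI2
    have t2 : Tendsto (fun y : ℝ => H y - st m (fun u => f u * u ^ 2) ((y : ℂ) * I)) atTop
        (𝓝 (((∫ u, f u * u ∂m) - α1 : ℝ) : ℂ)) := by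
      refine tendsto_const_nhds.congr' ?_
      filter_upwards [eventually_ge_atTop Y] with y hy
      rw [hHe y hy]; ring
    have := tendsto_nhds_unique t1 t2
    have : (0 : ℝ) = (∫ u, f u * u ∂m) - α1 := by exact_mod_cast this
    linarith
  refine ⟨hI2, hI1, hα0, hα1, fun y hy => ?_⟩
  rw [hHe y hy, ← hα1]
  simp



theorem cauchy_st (m : Measure ℝ) (z : ℂ) : cauchy m z = st m (fun _ => 1) z := by
  simp [cauchy, st]

theorem im_ker (z : ℂ) (u : ℝ) :
    ((z - (u : ℂ))⁻¹).im = - z.im * (‖z - (u : ℂ)‖ ^ 2)⁻¹ := by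
  rw [Complex.inv_im, Complex.normSq_eq_norm_sq]
  simp [div_eq_mul_inv]

theorem int_inv_sq (m : Measure ℝ) [IsFiniteMeasure m] (z : ℂ) (hz : 0 < z.im) :
    Integrable (fun u : ℝ => (‖z - (u : ℂ)‖ ^ 2)⁻¹) m := by
  refine (integrable_const ((1 / z.im) ^ 2)).mono' (Measurable.aestronglyMeasurable (by fun_prop)) ?_
  filter_upwards with u
  rw [Real.norm_eq_abs, abs_of_nonneg (by positivity), ← inv_pow, ← norm_inv]
  exact pow_le_pow_left₀ (norm_nonneg _) (norm_inv_le z hz u) 2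

theorem cauchy_im (m : Measure ℝ) [IsFiniteMeasure m] (z : ℂ) (hz : 0 < z.im) :
    (cauchy m z).im = - z.im * ∫ u : ℝ, (‖z - (u : ℂ)‖ ^ 2)⁻¹ ∂m := by
  unfold cauchy
  have hi : Integrable (fun u : ℝ => (z - (u : ℂ))⁻¹) m := by
    simpa using st_int (integrable_const (1 : ℝ)) hz (m := m)
  have e3 := imCLM.integral_comp_comm hi
  simp only [imCLM_apply] at e3
  rw [← e3, ← integral_const_mul]
  congr 1; ext u; exact im_ker z u

theorem cauchy_im_neg (m : Measure ℝ) [IsProbabilityMeasure m] (z : ℂ) (hz : 0 < z.im) :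
    (cauchy m z).im < 0 := by
  rw [cauchy_im m z hz]
  have : 0 < ∫ u : ℝ, (‖z - (u : ℂ)‖ ^ 2)⁻¹ ∂m := by
    rw [integral_pos_iff_support_of_nonneg (fun u => by positivity) (int_inv_sq m z hz)]
    have : Function.support (fun u : ℝ => (‖z - (u : ℂ)‖ ^ 2)⁻¹) = Set.univ := by
      ext u
      simp [sub_ne z hz u]
    rw [this]; simp
  nlinarith

theorem recip_im_pos (m : Measure ℝ) [IsProbabilityMeasure m] (z : ℂ) (hz : 0 < z.im) :
    0 < (recip m z).im := by
  have h := cauchy_im_neg m z hz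
  have h0 : cauchy m z ≠ 0 := by
    intro h1; rw [h1] at h; simp at h
  unfold recip
  rw [Complex.inv_im]
  exact div_pos (by linarith) (Complex.normSq_pos.2 h0)

theorem pow_int {μ : Measure ℝ} [IsFiniteMeasure μ] {K : ℕ}
    (h8 : Integrable (fun u => |u| ^ K) μ) (k : ℕ) (hk : k ≤ K) : Integrable (fun u : ℝ => u ^ k) μ := by
  refine ((integrable_const (1 : ℝ)).add h8).mono' (Measurable.aestronglyMeasurable (by fun_prop)) ?_
  filter_upwards with u
  show ‖u ^ k‖ ≤ 1 + |u| ^ K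
  rw [norm_pow, Real.norm_eq_abs]
  rcases le_total |u| 1 with h | h
  · have := pow_le_one₀ (n := k) (abs_nonneg u) h
    have := pow_nonneg (abs_nonneg u) K
    linarith
  · have := pow_le_pow_right₀ h hk
    linarith

theorem tau_moments
    (μ : Measure ℝ) [IsProbabilityMeasure μ]
    (h8 : Integrable (fun u => u ^ 8) μ)
    (h1 : mom μ 1 = 0) (h2 : mom μ 2 = 1)
    (τ : Measure ℝ) [IsProbabilityMeasure τ]
    (hτ : ∀ z : ℂ, 0 < z.im → recip μ z = z + ∫ u, ((u : ℂ) - z)⁻¹ ∂τ) :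
    Integrable (fun u => u ^ 6) τ ∧ ∫ u, u ∂τ = mom μ 3 ∧ ∫ u, u ^ 2 ∂τ = mom μ 4 - 1 := by
  have h8' : Integrable (fun u : ℝ => |u| ^ 8) μ := by
    convert h8 using 2 with u
    exact Even.pow_abs (by decide) u
  have hp : ∀ k ≤ 8, Integrable (fun u : ℝ => u ^ k) μ := pow_int h8'
  set g : ℕ → ℂ → ℂ := fun k z => st μ (fun u => u ^ k) z with hg
  set m : ℕ → ℝ := mom μ with hm
  have hrec : ∀ z : ℂ, 0 < z.im → ∀ k < 8, z * g k z = m k + g (k + 1) z := by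
    intro z hz k hk
    have := st_mul (hp k hk.le) (by simpa [pow_succ] using hp (k + 1) hk) hz
    simp only [hg, pow_succ]
    exact this
  have hm0 : m 0 = 1 := by simp [hm, mom]
  set N : ℂ → ℂ := fun z => st τ (fun _ => 1) z with hN
  have hNg : ∀ z : ℂ, 0 < z.im → N z * g 0 z = z * g 0 z - 1 := by
    intro z hz
    have e := hτ z hz
    have h := cauchy_im_neg μ z hz
    have h0 : cauchy μ z ≠ 0 := by
      intro h1; rw [h1] at h; simp at h
    have e1 : ∫ u : ℝ, ((u : ℂ) - z)⁻¹ ∂τ = - N z := by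
      simp only [hN, st]
      rw [← integral_neg]
      congr 1; ext u
      simp
      rw [← inv_neg, neg_sub]
    have e2 : g 0 z = cauchy μ z := by
      simp [hg, cauchy_st]
    rw [e1] at e
    rw [e2]
    unfold recip at e
    have e4 : N z = z - (cauchy μ z)⁻¹ := by rw [e]; ring
    rw [e4]
    field_simp
  -- algebraic identities
  have hN1 : ∀ z : ℂ, 0 < z.im → N z * g 0 z = g 1 z := by
    intro z hz
    rw [hNg z hz, hrec z hz 0 (by norm_num), hm0]; simp
  have hz0 : ∀ z : ℂ, 0 < z.im → z ≠ 0 := by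
    intro z hz h; rw [h] at hz; simp at hz
  set M : ℝ := ∑ k ∈ Finset.range 9, ∫ u, |u ^ k| ∂μ with hM
  have hMk : ∀ k ≤ 8, ∀ y : ℝ, 0 < y → ‖g k ((y : ℂ) * I)‖ ≤ M / y := by
    intro k hk y hy
    have := st_bound (fun u => u ^ k) (z := (y : ℂ) * I) (by simpa using hy) (hp k hk)
    simp only [Complex.mul_im, Complex.ofReal_re, Complex.I_im, mul_one, Complex.ofReal_im, Complex.I_re, mul_zero, add_zero] at this
    refine this.trans (div_le_div_of_nonneg_right ?_ hy.le)
    exact Finset.single_le_sum (f := fun k => ∫ u, |u ^ k| ∂μ)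
      (fun i _ => integral_nonneg fun u => abs_nonneg _) (Finset.mem_range.2 (by omega))
  have hM0 : 0 ≤ M := Finset.sum_nonneg fun i _ => integral_nonneg fun u => abs_nonneg _
  set Y : ℝ := 2 * M + 1 with hY
  have hY0 : 0 < Y := by positivity
  have hden : ∀ y : ℝ, Y ≤ y → 1 / 2 ≤ ‖1 + g 1 ((y : ℂ) * I)‖ := by
    intro y hy
    have hy0 : 0 < y := hY0.trans_le hy
    have e := hMk 1 (by norm_num) y hy0
    have e2 : M / y ≤ 1 / 2 := by
      rw [div_le_div_iff₀ hy0 (by norm_num)]; linarith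
    have := norm_sub_le_norm_add (1 : ℂ) (g 1 ((y : ℂ) * I))
    rw [norm_one] at this
    linarith
  set β : ℝ := m 4 - 1 with hβ
  set α3 : ℝ := m 5 - 2 * m 3 with hα3
  set α4 : ℝ := m 6 - m 4 - m 3 ^ 2 - β with hα4
  set α5 : ℝ := m 7 - m 5 - m 3 * m 4 - β * m 3 - α3 with hα5
  set N2 : ℂ → ℂ := fun z => z ^ 2 * N z - z - m 3 with hN2
  set N4 : ℂ → ℂ := fun z => z ^ 2 * N2 z - β * z - α3 with hN4
  set N6 : ℂ → ℂ := fun z => z ^ 2 * N4 z - α4 * z - α5 with hN6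
  have id2 : ∀ z : ℂ, 0 < z.im → N2 z * (1 + g 1 z) = g 4 z - g 2 z - m 3 * g 1 z := by
    intro z hz
    have r0 := hrec z hz 0 (by norm_num)
    have r1 := hrec z hz 1 (by norm_num)
    have r2 := hrec z hz 2 (by norm_num)
    have r3 := hrec z hz 3 (by norm_num)
    have n1 := hN1 z hz
    rw [hm0] at r0
    have hm1 : m 1 = 0 := h1
    have hm2 : m 2 = 1 := h2
    rw [hm1] at r1
    rw [hm2] at r2
    simp only [hN2]
    push_cast at r0 r1 r2 r3 ⊢
    norm_num at r0 r1 r2 r3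
    have k1 : z ^ 2 * N z * (1 + g 1 z) = z ^ 3 * g 1 z := by
      rw [← r0, ← n1]; ring
    linear_combination k1 + z ^ 2 * r1 + z * r2 + r3 - r1
  have id4 : ∀ z : ℂ, 0 < z.im → N4 z * (1 + g 1 z) =
      g 6 z - g 4 z - m 3 * g 3 z - β * g 2 z - α3 * g 1 z := by
    intro z hz
    have r1 := hrec z hz 1 (by norm_num)
    have r2 := hrec z hz 2 (by norm_num)
    have r3 := hrec z hz 3 (by norm_num)
    have r4 := hrec z hz 4 (by norm_num)
    have r5 := hrec z hz 5 (by norm_num)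
    have n1 := id2 z hz
    have hm1 : m 1 = 0 := h1
    have hm2 : m 2 = 1 := h2
    rw [hm1] at r1
    rw [hm2] at r2
    simp only [hN4]
    simp only [hα3, hβ]
    norm_num at r1 r2 r3 r4 r5
    push_cast
    linear_combination z ^ 2 * n1 + z * r4 + r5 - z * r2 - r3 - m 3 * z * r1 - m 3 * r2 - (m 4 - 1) * r1
  have id6 : ∀ z : ℂ, 0 < z.im → N6 z * (1 + g 1 z) =
      g 8 z - g 6 z - m 3 * g 5 z - β * g 4 z - α3 * g 3 z - α4 * g 2 z - α5 * g 1 z := by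
    intro z hz
    have r1 := hrec z hz 1 (by norm_num)
    have r2 := hrec z hz 2 (by norm_num)
    have r3 := hrec z hz 3 (by norm_num)
    have r4 := hrec z hz 4 (by norm_num)
    have r5 := hrec z hz 5 (by norm_num)
    have r6 := hrec z hz 6 (by norm_num)
    have r7 := hrec z hz 7 (by norm_num)
    have n1 := id4 z hz
    have hm1 : m 1 = 0 := h1
    have hm2 : m 2 = 1 := h2
    rw [hm1] at r1
    rw [hm2] at r2
    simp only [hN6]
    simp only [hα5, hα4]
    norm_num at r1 r2 r3 r4 r5 r6 r7
    push_cast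
    linear_combination z ^ 2 * n1 + z * r6 + r7 - z * r4 - r5 - m 3 * (z * r3 + r4) - β * (z * r2 + r3)
      - α3 * (z * r1 + r2) - (m 6 - m 4 - m 3 ^ 2 - β) * r1
  have him : ∀ y : ℝ, Y ≤ y → 0 < ((y : ℂ) * I).im := by
    intro y hy; simp; linarith
  have hgb : ∀ (k : ℕ) (c : ℝ), k ≤ 8 → ∀ y : ℝ, Y ≤ y → ‖(c : ℂ) * g k ((y : ℂ) * I)‖ ≤ |c| * (M / y) := by
    intro k c hk y hy
    rw [norm_mul, Complex.norm_real, Real.norm_eq_abs]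
    exact mul_le_mul_of_nonneg_left (hMk k hk y (hY0.trans_le hy)) (abs_nonneg _)
  have hquot : ∀ (A B R : ℂ) (y c : ℝ), 1 / 2 ≤ ‖B‖ → A * B = R → ‖R‖ ≤ c * (M / y) →
      ‖A‖ ≤ (2 * c * M) / y := by
    intro A B R y c hB hAB hR
    rw [← hAB, norm_mul] at hR
    have e : (2 * c * M) / y = 2 * (c * (M / y)) := by ring
    rw [e]
    nlinarith [norm_nonneg A]
  have b2 : ∀ y : ℝ, Y ≤ y → ‖N2 ((y : ℂ) * I)‖ ≤ (2 * (1 + 1 + |m 3|) * M) / y := by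
    intro y hy
    refine hquot _ _ _ y _ (hden y hy) (id2 _ (him y hy)) ?_
    have q4 := hMk 4 (by norm_num) y (hY0.trans_le hy)
    have q2 := hMk 2 (by norm_num) y (hY0.trans_le hy)
    have q1 := hgb 1 (m 3) (by norm_num) y hy
    refine (norm_sub_le_of_le (norm_sub_le_of_le q4 q2) q1).trans (le_of_eq ?_)
    ring
  have b4 : ∀ y : ℝ, Y ≤ y → ‖N4 ((y : ℂ) * I)‖ ≤ (2 * (1 + 1 + |m 3| + |β| + |α3|) * M) / y := by
    intro y hy
    refine hquot _ _ _ y _ (hden y hy) (id4 _ (him y hy)) ?_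
    refine (norm_sub_le_of_le (norm_sub_le_of_le (norm_sub_le_of_le
      (norm_sub_le_of_le (hMk 6 (by norm_num) y (hY0.trans_le hy)) (hMk 4 (by norm_num) y (hY0.trans_le hy)))
      (hgb 3 (m 3) (by norm_num) y hy)) (hgb 2 β (by norm_num) y hy))
      (hgb 1 α3 (by norm_num) y hy)).trans (le_of_eq ?_)
    ring
  have b6 : ∀ y : ℝ, Y ≤ y → ‖N6 ((y : ℂ) * I)‖ ≤
      (2 * (1 + 1 + |m 3| + |β| + |α3| + |α4| + |α5|) * M) / y := by
    intro y hy
    refine hquot _ _ _ y _ (hden y hy) (id6 _ (him y hy)) ?_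
    refine (norm_sub_le_of_le (norm_sub_le_of_le (norm_sub_le_of_le (norm_sub_le_of_le (norm_sub_le_of_le
      (norm_sub_le_of_le (hMk 8 (by norm_num) y (hY0.trans_le hy)) (hMk 6 (by norm_num) y (hY0.trans_le hy)))
      (hgb 5 (m 3) (by norm_num) y hy)) (hgb 4 β (by norm_num) y hy))
      (hgb 3 α3 (by norm_num) y hy)) (hgb 2 α4 (by norm_num) y hy))
      (hgb 1 α5 (by norm_num) y hy)).trans (le_of_eq ?_)
    ring
  obtain ⟨i2, i1, s0, s1, sH⟩ := step τ (fun _ => 1) (fun _ => zero_le_one) continuous_const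
    (integrable_const _) 1 (m 3) (fun y => N2 ((y : ℂ) * I)) _ Y hY0
    (fun y hy => by simp only [hN2, hN]; push_cast; ring) b2
  obtain ⟨i4, i3, s2, s3, sH2⟩ := step τ (fun u => 1 * u ^ 2) (fun _ => by positivity) (by fun_prop)
    i2 β α3 (fun y => N4 ((y : ℂ) * I)) _ Y hY0
    (fun y hy => by rw [← sH y hy]; simp only [hN4]; ring) b4
  obtain ⟨i6, -⟩ := step τ (fun u => 1 * u ^ 2 * u ^ 2) (fun _ => by positivity) (by fun_prop)
    i4 α4 α5 (fun y => N6 ((y : ℂ) * I)) _ Y hY0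
    (fun y hy => by rw [← sH2 y hy]; simp only [hN6]; ring) b6
  refine ⟨?_, ?_, ?_⟩
  · convert i6 using 2; ring
  · rw [s1]; simp
  · rw [s2]; simp



theorem e_facts (β ε : ℝ) (hβ : 0 ≤ β) (hε : 0 < ε) (hκ : (β + 1) * ε ≤ 1 / 100) (e : ℝ)
    (he : e = (1 - β * ε) / Real.sqrt (1 - (β + 1) * ε)) :
    9 / 10 ≤ e ∧ e ≤ 11 / 10 ∧
    |1 / e - β * ε - e * (1 - ε)| ≤ 5 * ((β + 1) * ε) ^ 2 ∧
    |1 / e ^ 2 - e * (1 - ε)| ≤ 6 * ((β + 1) * ε) := by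
  set b := β * ε with hb
  have hb0 : 0 ≤ b := by positivity
  set κ := (β + 1) * ε with hk
  have hkb : κ = b + ε := by rw [hk, hb]; ring
  have hD : 0 < 1 - κ := by linarith
  have hs := Real.sqrt_pos.2 hD
  have he0 : 0 < e := by rw [he]; exact div_pos (by linarith) hs
  have he2 : e ^ 2 * (1 - κ) = (1 - b) ^ 2 := by
    rw [he, div_pow, Real.sq_sqrt hD.le]; field_simp
  have hk2 : b ^ 2 ≤ κ * b := by nlinarith
  have h1 : |e ^ 2 - 1| ≤ 2 * κ := by
    rw [abs_le]; constructor
    · nlinarith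
    · nlinarith
  have h2 : |e - 1| ≤ 2 * κ := by
    have : |e - 1| * (e + 1) = |e ^ 2 - 1| := by
      have h9 : e ^ 2 - 1 = (e - 1) * (e + 1) := by ring
      rw [h9, abs_mul, abs_of_pos (show 0 < e + 1 by linarith)]
    nlinarith [abs_nonneg (e - 1)]
  have h2' := abs_le.1 h2
  have h1' := abs_le.1 h1
  have l : 9 / 10 ≤ e := by linarith
  have u : e ≤ 11 / 10 := by linarith
  refine ⟨l, u, ?_, ?_⟩
  · have k1 : |1 - b * e - e ^ 2 * (1 - ε)| ≤ 4 * κ ^ 2 := by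
      have k2 : (1 - b * e - e ^ 2 * (1 - ε)) * (1 - κ) = b * (1 - e) * (1 - κ) - (1 - b) * b * ε := by
        have : (1 - b * e - e ^ 2 * (1 - ε)) * (1 - κ) = (1 - b * e) * (1 - κ) - (e ^ 2 * (1 - κ)) * (1 - ε) := by ring
        rw [this, he2, hkb]; ring
      have k3 : |b * (1 - e)| ≤ 2 * κ ^ 2 := by
        rw [abs_mul, abs_of_nonneg hb0, abs_sub_comm]
        nlinarith [abs_nonneg (e - 1)]
      have k3' := abs_le.1 k3
      have k4 : (1 - b) * b * ε ≤ κ ^ 2 := by nlinarith [mul_nonneg hb0 hε.le, mul_nonneg hb0 (mul_nonneg hb0 hε.le)]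
      have k5 : 0 ≤ (1 - b) * b * ε := by
        apply mul_nonneg (mul_nonneg (by linarith) hb0) hε.le
      have hq := sq_nonneg κ
      have hX : ∀ X : ℝ, X * (1 - κ) ≤ 2 * κ ^ 2 * (1 - κ) → X ≤ 2 * κ ^ 2 := fun X h => le_of_mul_le_mul_right h hD
      rw [abs_le]; constructor
      · by_contra hc
        push Not at hc
        nlinarith
      · by_contra hc
        push Not at hc
        nlinarith
    have k2 : 1 / e - b - e * (1 - ε) = (1 - b * e - e ^ 2 * (1 - ε)) / e := by field_simp
    rw [k2, abs_div, abs_of_pos he0, div_le_iff₀ he0]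
    nlinarith [sq_nonneg κ]
  · have k1 : |1 / e ^ 2 - 1| ≤ 3 * κ := by
      have : 1 / e ^ 2 - 1 = (1 - e ^ 2) / e ^ 2 := by field_simp
      rw [this, abs_div, abs_sub_comm, abs_of_pos (show 0 < e ^ 2 by positivity), div_le_iff₀ (by positivity)]
      nlinarith
    have k2 : |1 - e * (1 - ε)| ≤ 3 * κ + 0 := by
      rw [abs_le]; constructor <;> nlinarith
    have : 1 / e ^ 2 - e * (1 - ε) = (1 / e ^ 2 - 1) + (1 - e * (1 - ε)) := by ring
    rw [this]
    refine (abs_add_le _ _).trans (by linarith)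

theorem core2 (β ε : ℝ) (hβ : 0 ≤ β) (hε : 0 < ε) (hκ : (β + 1) * ε ≤ 1 / 100) (e : ℝ)
    (he : e = (1 - β * ε) / Real.sqrt (1 - (β + 1) * ε)) (v : ℂ) (hv : 0 < v.im) (hv2 : 1 / 2 ≤ ‖v‖) :
    0 < ((e : ℂ) * v - (β * ε : ℝ) / v).im ∧
    ‖((e : ℂ) * v - (β * ε : ℝ) / v) + 1 / ((e : ℂ) * v - (β * ε : ℝ) / v)
      - e * (v + (1 - ε : ℝ) / v + (1 - ε : ℝ) * (β * ε : ℝ) / v ^ 3)‖ ≤ 200 * ((β + 1) * ε) ^ 2 := by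
  obtain ⟨l, u, f1, f2⟩ := e_facts β ε hβ hε hκ e he
  set b := β * ε with hb
  have hb0 : 0 ≤ b := by positivity
  set κ := (β + 1) * ε with hk
  have hkb : κ = b + ε := by rw [hk, hb]; ring
  have hv0 : v ≠ 0 := by intro h; rw [h] at hv; simp at hv
  have he0 : 0 < e := by linarith
  have heC : (e : ℂ) ≠ 0 := by exact_mod_cast he0.ne'
  have hnv : 0 < ‖v‖ := by linarith
  have hD : 1 / 8 ≤ ‖(e : ℂ) * v ^ 2 - b‖ := by
    have h := norm_sub_norm_le ((e : ℂ) * v ^ 2) (b : ℂ)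
    rw [norm_mul, norm_pow, Complex.norm_real, Complex.norm_real, Real.norm_eq_abs, Real.norm_eq_abs,
      abs_of_pos he0, abs_of_nonneg hb0] at h
    have : 1 / 4 ≤ ‖v‖ ^ 2 := by nlinarith
    nlinarith
  have hD0 : (e : ℂ) * v ^ 2 - b ≠ 0 := by
    intro h; rw [h] at hD; norm_num at hD
  constructor
  · have : ((e : ℂ) * v - (b : ℝ) / v).im = e * v.im + b * (v.im / Complex.normSq v) := by
      rw [Complex.sub_im, Complex.im_ofReal_mul, div_eq_mul_inv, Complex.im_ofReal_mul, Complex.inv_im]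
      ring
    rw [this]
    have h3 : 0 ≤ v.im / Complex.normSq v := div_nonneg hv.le (Complex.normSq_nonneg _)
    have := mul_pos he0 hv
    have := mul_nonneg hb0 h3
    linarith
  · have key : ((e : ℂ) * v - (b : ℝ) / v) + 1 / ((e : ℂ) * v - (b : ℝ) / v)
      - e * (v + (1 - ε : ℝ) / v + (1 - ε : ℝ) * (b : ℝ) / v ^ 3) =
        ((1 / e - b - e * (1 - ε) : ℝ) : ℂ) * v⁻¹ + ((b * (1 / e ^ 2 - e * (1 - ε)) : ℝ) : ℂ) * (v⁻¹) ^ 3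
        + ((b ^ 2 / e ^ 2 : ℝ) : ℂ) * (v⁻¹) ^ 3 * ((e : ℂ) * v ^ 2 - b)⁻¹ := by
      have e1 : ((e : ℂ) * v - (b : ℝ) / v) = ((e : ℂ) * v ^ 2 - b) / v := by field_simp
      rw [e1]
      push_cast
      generalize hDD : (e : ℂ) * v ^ 2 - b = D at hD0 ⊢
      have hbb : (b : ℂ) = e * v ^ 2 - D := by rw [← hDD]; ring
      rw [hbb]
      field_simp
      ring
    rw [key]
    have hvi : ‖v⁻¹‖ ≤ 2 := by
      rw [norm_inv]
      exact inv_le_of_inv_le₀ (by norm_num) (by linarith)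
    have hvi3 : ‖v⁻¹ ^ 3‖ ≤ 8 := by
      rw [norm_pow]
      calc ‖v⁻¹‖ ^ 3 ≤ 2 ^ 3 := pow_le_pow_left₀ (norm_nonneg _) hvi 3
        _ = 8 := by norm_num
    have hDi : ‖((e : ℂ) * v ^ 2 - b)⁻¹‖ ≤ 8 := by
      rw [norm_inv]
      exact inv_le_of_inv_le₀ (by norm_num) (by linarith)
    have t1 : ‖((1 / e - b - e * (1 - ε) : ℝ) : ℂ) * v⁻¹‖ ≤ (5 * κ ^ 2) * 2 := by
      rw [norm_mul, Complex.norm_real, Real.norm_eq_abs]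
      exact mul_le_mul f1 hvi (norm_nonneg _) (by positivity)
    have t2 : ‖((b * (1 / e ^ 2 - e * (1 - ε)) : ℝ) : ℂ) * (v⁻¹) ^ 3‖ ≤ (6 * κ ^ 2) * 8 := by
      rw [norm_mul, Complex.norm_real, Real.norm_eq_abs, abs_mul, abs_of_nonneg hb0]
      refine mul_le_mul ?_ hvi3 (norm_nonneg _) (by positivity)
      nlinarith [abs_nonneg (1 / e ^ 2 - e * (1 - ε))]
    have t3 : ‖((b ^ 2 / e ^ 2 : ℝ) : ℂ) * (v⁻¹) ^ 3 * ((e : ℂ) * v ^ 2 - b)⁻¹‖ ≤ (2 * κ ^ 2) * 8 * 8 := by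
      rw [norm_mul, norm_mul, Complex.norm_real, Real.norm_eq_abs, abs_of_nonneg (by positivity)]
      refine mul_le_mul (mul_le_mul ?_ hvi3 (norm_nonneg _) (by positivity)) hDi (norm_nonneg _) (by positivity)
      rw [div_le_iff₀ (by positivity)]
      have : b ^ 2 ≤ κ ^ 2 := pow_le_pow_left₀ hb0 (by linarith) 2
      have h7 : 1 ≤ 2 * e ^ 2 := by nlinarith
      nlinarith [mul_le_mul_of_nonneg_left h7 (sq_nonneg κ)]
    refine (norm_add_le_of_le (norm_add_le_of_le t1 t2) t3).trans ?_
    nlinarith [sq_nonneg κ]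

theorem core3 (ζ δ : ℝ) (hζ : |ζ| < 2) (hδ : δ ≤ 1) (W : ℂ) (hW : 0 < W.im)
    (h : ‖W + 1 / W - ζ‖ ≤ δ) :
    ‖W - ((ζ / 2 : ℝ) + (Real.sqrt (4 - ζ ^ 2) / 2 : ℝ) * I)‖ ≤ 8 * δ / Real.sqrt (4 - ζ ^ 2) := by
  have hz2 : 0 < 4 - ζ ^ 2 := by
    have := sq_abs ζ
    nlinarith [abs_nonneg ζ]
  set s := Real.sqrt (4 - ζ ^ 2) with hs
  have hs0 : 0 < s := Real.sqrt_pos.2 hz2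
  have hss : s ^ 2 = 4 - ζ ^ 2 := Real.sq_sqrt hz2.le
  have hW0 : W ≠ 0 := by intro h; rw [h] at hW; simp at hW
  have hδ0 : 0 ≤ δ := (norm_nonneg _).trans h
  have hWb : ‖W‖ ≤ 4 := by
    rcases le_total ‖W‖ 1 with h1 | h1
    · linarith
    · have e : W = (W + 1 / W - ζ) + ζ - W⁻¹ := by field_simp; ring
      have e2 : ‖W⁻¹‖ ≤ 1 := by rw [norm_inv]; exact inv_le_one_of_one_le₀ h1
      have e3 : ‖(ζ : ℂ)‖ ≤ 2 := by rw [Complex.norm_real, Real.norm_eq_abs]; exact hζ.le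
      calc ‖W‖ = ‖(W + 1 / W - ζ) + ζ - W⁻¹‖ := by rw [← e]
        _ ≤ δ + 2 + 1 := norm_sub_le_of_le (norm_add_le_of_le h e3) e2
        _ ≤ 4 := by linarith
  have fac : (W - ((ζ / 2 : ℝ) + (s / 2 : ℝ) * I)) * (W - ((ζ / 2 : ℝ) - (s / 2 : ℝ) * I)) = (W + 1 / W - ζ) * W := by
    have hssC : (s : ℂ) ^ 2 = 4 - ζ ^ 2 := by exact_mod_cast hss
    have : (W + 1 / W - ζ) * W = W ^ 2 + 1 - ζ * W := by field_simp
    rw [this]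
    push_cast
    linear_combination (-(s : ℂ) ^ 2 / 4) * Complex.I_sq + hssC / 4
  have low : s / 2 ≤ ‖W - ((ζ / 2 : ℝ) - (s / 2 : ℝ) * I)‖ := by
    refine le_trans ?_ ((le_abs_self _).trans (Complex.abs_im_le_norm _))
    simp
    linarith
  have := congrArg norm fac
  rw [norm_mul, norm_mul] at this
  rw [le_div_iff₀ hs0]
  have h5 : ‖W + 1 / W - ζ‖ * ‖W‖ ≤ δ * 4 := mul_le_mul h hWb (norm_nonneg _) hδ0
  nlinarith [norm_nonneg (W - ((ζ / 2 : ℝ) + (s / 2 : ℝ) * I))]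

theorem core4 (e b : ℝ) (hb : 0 ≤ b) (hb2 : b ≤ 1 / 100) (he : 9 / 10 ≤ e) (v w : ℂ)
    (hv : 1 / 2 ≤ ‖v‖) (hw : 1 / 2 ≤ ‖w‖) :
    ‖v - w‖ ≤ 2 * ‖((e : ℂ) * v - b / v) - ((e : ℂ) * w - b / w)‖ := by
  have hv0 : v ≠ 0 := by intro h; rw [h] at hv; norm_num at hv
  have hw0 : w ≠ 0 := by intro h; rw [h] at hw; norm_num at hw
  have k : ((e : ℂ) * v - b / v) - ((e : ℂ) * w - b / w) = (v - w) * (e + b / (v * w)) := by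
    field_simp; ring
  rw [k, norm_mul]
  have h1 := norm_sub_le_norm_add (e : ℂ) (b / (v * w))
  rw [Complex.norm_real, Real.norm_eq_abs, abs_of_pos (by linarith), norm_div, Complex.norm_real,
    Real.norm_eq_abs, abs_of_nonneg hb, norm_mul] at h1
  have h2 : b / (‖v‖ * ‖w‖) ≤ 1 / 10 := by
    rw [div_le_iff₀ (by positivity)]
    nlinarith
  have h3 : 1 / 2 ≤ ‖(e : ℂ) + b / (v * w)‖ := by linarith
  nlinarith [norm_nonneg (v - w)]


theorem st_shift {m : Measure ℝ} {f : ℝ → ℝ} (α : ℝ) (hf : Integrable f m)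
    (hf' : Integrable (fun u => f u * (u - α)) m) {z : ℂ} (hz : 0 < z.im) :
    (z - α) * st m f z = ((∫ u, f u ∂m : ℝ) : ℂ) + st m (fun u => f u * (u - α)) z := by
  unfold st
  rw [← integral_const_mul, ← integral_complex_ofReal]
  refine Eq.trans ?_ (integral_add hf.ofReal (st_int hf' hz))
  congr 1
  ext u
  have := sub_ne z hz u
  field_simp
  push_cast
  ring

theorem q_low (σ : Measure ℝ) [IsFiniteMeasure σ] (α n : ℝ) (hn0 : 0 < n) (Z : ℂ) (hZ : 0 < Z.im)
    (i0 : Integrable (fun u : ℝ => (u - α) ^ 0) σ) (i2 : Integrable (fun u : ℝ => (u - α) ^ 2) σ) :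
    (2 / n - 2 * ‖Z - α‖ ^ 2 / n ^ 2) * (∫ u : ℝ, (u - α) ^ 0 ∂σ) - (2 / n ^ 2) * (∫ u : ℝ, (u - α) ^ 2 ∂σ)
      ≤ ∫ u : ℝ, (‖Z - (u : ℂ)‖ ^ 2)⁻¹ ∂σ := by
  have j0 : Integrable (fun u : ℝ => (2 / n - 2 * ‖Z - α‖ ^ 2 / n ^ 2) * (u - α) ^ 0) σ := i0.const_mul _
  have j2 : Integrable (fun u : ℝ => (2 / n ^ 2) * (u - α) ^ 2) σ := i2.const_mul _
  rw [← integral_const_mul, ← integral_const_mul, ← integral_sub j0 j2]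
  refine integral_mono (j0.sub j2) (int_inv_sq σ Z hZ) ?_
  intro u
  show (2 / n - 2 * ‖Z - α‖ ^ 2 / n ^ 2) * (u - α) ^ 0 - (2 / n ^ 2) * (u - α) ^ 2 ≤ (‖Z - (u : ℂ)‖ ^ 2)⁻¹
  rw [pow_zero, mul_one]
  have hq0 : 0 < ‖Z - (u : ℂ)‖ := norm_pos_iff.2 (sub_ne Z hZ u)
  have h1 : ‖Z - (u : ℂ)‖ ≤ ‖Z - α‖ + |u - α| := by
    have : Z - (u : ℂ) = (Z - α) - ((u - α : ℝ) : ℂ) := by push_cast; ring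
    rw [this]
    refine (norm_sub_le _ _).trans ?_
    rw [Complex.norm_real, Real.norm_eq_abs]
  generalize ‖Z - (u : ℂ)‖ = q at *
  generalize ‖Z - (α : ℂ)‖ = V at *
  have hq2 : q ^ 2 ≤ 2 * V ^ 2 + 2 * (u - α) ^ 2 := by
    rw [← sq_abs (u - α)]
    nlinarith [sq_nonneg (V - |u - α|), abs_nonneg (u - α)]
  have h2 : 2 / n - (1 / n ^ 2) * q ^ 2 ≤ (q ^ 2)⁻¹ := by
    have : (q ^ 2)⁻¹ - (2 / n - (1 / n ^ 2) * q ^ 2) = (1 / q - q / n) ^ 2 := by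
      field_simp; ring
    nlinarith [sq_nonneg (1 / q - q / n)]
  have h3 : (1 / n ^ 2) * q ^ 2 ≤ (1 / n ^ 2) * (2 * V ^ 2 + 2 * (u - α) ^ 2) :=
    mul_le_mul_of_nonneg_left hq2 (by positivity)
  have h4 : (1 / n ^ 2) * (2 * V ^ 2 + 2 * (u - α) ^ 2) = 2 * V ^ 2 / n ^ 2 + 2 / n ^ 2 * (u - α) ^ 2 := by ring
  linarith

theorem r_bd (σ : Measure ℝ) [IsFiniteMeasure σ] (α r : ℝ) (hr0 : 0 < r) (Z : ℂ) (hZ : 0 < Z.im)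
    (i6 : Integrable (fun u : ℝ => (u - α) ^ 6) σ) :
    ‖st σ (fun u => (u - α) ^ 3) Z‖ ≤ (1 / (2 * r)) * (∫ u : ℝ, (u - α) ^ 6 ∂σ)
      + (r / 2) * ∫ u : ℝ, (‖Z - (u : ℂ)‖ ^ 2)⁻¹ ∂σ := by
  have j0 : Integrable (fun u : ℝ => (1 / (2 * r)) * (u - α) ^ 6) σ := i6.const_mul _
  have j2 : Integrable (fun u : ℝ => (r / 2) * (‖Z - (u : ℂ)‖ ^ 2)⁻¹) σ := (int_inv_sq σ Z hZ).const_mul _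
  rw [← integral_const_mul, ← integral_const_mul, ← integral_add j0 j2]
  unfold st
  refine norm_integral_le_of_norm_le (j0.add j2) ?_
  filter_upwards with u
  rw [norm_mul, norm_inv, Complex.norm_real, norm_pow, Real.norm_eq_abs, ← inv_pow]
  have e6 : (u - α) ^ 6 = (|u - α| ^ 3) ^ 2 := by
    rw [← pow_mul]; exact (Even.pow_abs (by decide) _).symm
  rw [e6]
  generalize |u - α| ^ 3 = A
  generalize ‖Z - (u : ℂ)‖⁻¹ = B
  have : (1 / (2 * r)) * A ^ 2 + (r / 2) * B ^ 2 - A * B = (1 / (2 * r)) * (A - r * B) ^ 2 := by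
    field_simp; ring
  have : 0 ≤ (1 / (2 * r)) * (A - r * B) ^ 2 := by positivity
  linarith

set_option maxHeartbeats 1000000 in
theorem core1 (σ : Measure ℝ) [IsFiniteMeasure σ] (α β K r : ℝ) (hβ : 0 ≤ β) (hK : 0 ≤ K)
    (hr : 1 ≤ r) (hr2 : 100 * (1 + K + β) ≤ r ^ 2)
    (hi : ∀ k ≤ 6, Integrable (fun u : ℝ => (u - α) ^ k) σ)
    (s0 : |∫ u : ℝ, (u - α) ^ 0 ∂σ - 1| ≤ K / r ^ 4)
    (s1 : |∫ u : ℝ, (u - α) ^ 1 ∂σ| ≤ K / r ^ 4)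
    (s2 : |∫ u : ℝ, (u - α) ^ 2 ∂σ - β| ≤ K / r ^ 4)
    (s6 : ∫ u : ℝ, (u - α) ^ 6 ∂σ ≤ K)
    (z Z : ℂ) (hz : 0 < z.im) (hZ : 0 < Z.im)
    (h : z = Z + ((r ^ 2 - 1 : ℝ) : ℂ) * cauchy σ Z) :
    r / 2 ≤ ‖Z - α‖ ∧
    ‖(z - α) - ((Z - α) + (r ^ 2 - 1 : ℝ) / (Z - α) + (r ^ 2 - 1 : ℝ) * β / (Z - α) ^ 3)‖
      ≤ (10 * K + 8) / r ^ 2 := by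
  have hr0 : 0 < r := by linarith
  have hn100 : 100 ≤ r ^ 2 := by linarith
  have hr10 : 10 ≤ r := by nlinarith
  set n := r ^ 2 with hn
  have hn4 : r ^ 4 = n ^ 2 := by rw [hn]; ring
  rw [hn4] at s0 s1 s2
  have hn0 : 0 < n := by linarith
  set Q := ∫ u : ℝ, (‖Z - (u : ℂ)‖ ^ 2)⁻¹ ∂σ with hQ
  have hQi := int_inv_sq σ Z hZ
  have hQ1 : (n - 1) * Q < 1 := by
    have e := congrArg Complex.im h
    rw [Complex.add_im, Complex.im_ofReal_mul, cauchy_im σ Z hZ, ← hQ] at e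
    rw [e] at hz
    have : 0 < Z.im * (1 - (n - 1) * Q) := by linarith
    have := pos_of_mul_pos_right this hZ.le
    linarith
  set V := Z - (α : ℂ) with hV
  have hVim : V.im = Z.im := by simp [hV]
  have hV0 : V ≠ 0 := by intro h; rw [h] at hVim; simp at hVim; linarith
  have hVp : 0 < ‖V‖ := norm_pos_iff.2 hV0
  set S0 := ∫ u : ℝ, (u - α) ^ 0 ∂σ with hS0
  set S1 := ∫ u : ℝ, (u - α) ^ 1 ∂σ with hS1
  set S2 := ∫ u : ℝ, (u - α) ^ 2 ∂σ with hS2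
  have hKn : K / n ^ 2 ≤ 1 / 10000 := by
    rw [div_le_div_iff₀ (by positivity) (by norm_num)]
    nlinarith
  have hKn' : K / n ^ 2 ≤ 1 := by linarith
  have s0' := abs_le.1 s0
  have s2' := abs_le.1 s2
  -- lower bound
  have hlow : n / 4 ≤ ‖V‖ ^ 2 := by
    have hle := q_low σ α n hn0 Z hZ (hi 0 (by norm_num)) (hi 2 (by norm_num))
    rw [← hQ, ← hS0, ← hS2, ← hV] at hle
    by_contra hc
    push Not at hc
    have hQn : n * ((2 / n - 2 * ‖V‖ ^ 2 / n ^ 2) * S0 - (2 / n ^ 2) * S2) =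
        2 * S0 - (2 * ‖V‖ ^ 2 * S0 + 2 * S2) / n := by field_simp; ring
    have h1 : (2 * ‖V‖ ^ 2 * S0 + 2 * S2) / n ≤ S0 / 2 + 4 / 100 := by
      rw [div_le_iff₀ hn0]
      nlinarith
    have h2 : 1.4 ≤ n * Q := by
      have := mul_le_mul_of_nonneg_left hle hn0.le
      rw [hQn] at this
      linarith
    have h3 : 1.4 * (n - 1) ≤ n := by nlinarith
    linarith
  have hVr : r / 2 ≤ ‖V‖ := by
    refine (pow_le_pow_iff_left₀ (by positivity) hVp.le two_ne_zero).1 ?_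
    rw [div_pow, ← hn]; linarith
  refine ⟨hVr, ?_⟩
  set R := st σ (fun u => (u - α) ^ 3) Z with hR
  have exp : V ^ 3 * cauchy σ Z = S0 * V ^ 2 + S1 * V + S2 + R := by
    have p0 := st_shift (m := σ) (f := fun u => (u - α) ^ 0) α (hi 0 (by norm_num))
      (by simpa only [← pow_succ] using hi 1 (by norm_num)) hZ
    have p1 := st_shift (m := σ) (f := fun u => (u - α) ^ 1) α (hi 1 (by norm_num))
      (by simpa only [← pow_succ] using hi 2 (by norm_num)) hZ
    have p2 := st_shift (m := σ) (f := fun u => (u - α) ^ 2) α (hi 2 (by norm_num))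
      (by simpa only [← pow_succ] using hi 3 (by norm_num)) hZ
    simp only [← pow_succ] at p0 p1 p2
    norm_num only at p0 p1 p2
    have p3 : cauchy σ Z = st σ (fun u => (u - α) ^ 0) Z := by
      rw [cauchy_st]; simp
    rw [p3]
    simp only [hS0, hS1, hS2, hR, hV]
    linear_combination (Z - α) ^ 2 * p0 + (Z - α) * p1 + p2
  have hRb : ‖R‖ ≤ (K + 2) / (2 * r) := by
    have h1 := r_bd σ α r hr0 Z hZ (hi 6 le_rfl)
    rw [← hQ, ← hR] at h1
    have h2 : n * Q ≤ 2 := by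
      have : 0 ≤ Q := integral_nonneg fun u => by positivity
      nlinarith
    have h3 : (r / 2) * Q ≤ 2 / (2 * r) := by
      rw [le_div_iff₀ (by positivity)]
      have : r / 2 * Q * (2 * r) = n * Q := by rw [hn]; ring
      linarith
    have h4 : (1 / (2 * r)) * ∫ u : ℝ, (u - α) ^ 6 ∂σ ≤ K / (2 * r) := by
      rw [div_eq_mul_one_div K, mul_comm K]
      exact mul_le_mul_of_nonneg_left s6 (by positivity)
    rw [add_div]
    linarith
  have hid : (z - α) - (V + (n - 1 : ℝ) / V + (n - 1 : ℝ) * β / V ^ 3) =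
      ((n - 1 : ℝ) : ℂ) * (((S0 - 1 : ℝ) : ℂ) * V⁻¹ + (S1 : ℂ) * V⁻¹ ^ 2 + ((S2 - β : ℝ) : ℂ) * V⁻¹ ^ 3 + R * V⁻¹ ^ 3) := by
    have e1 : cauchy σ Z = (S0 * V ^ 2 + S1 * V + S2 + R) / V ^ 3 := by
      rw [← exp]; field_simp
    rw [h, e1]
    have : Z = V + α := by rw [hV]; ring
    rw [this]
    push_cast
    field_simp
    ring
  rw [hid, norm_mul]
  have hVi : ‖V⁻¹‖ ≤ 2 / r := by
    rw [norm_inv]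
    rw [show 2 / r = (r / 2)⁻¹ by field_simp]
    exact inv_anti₀ (by positivity) hVr
  have hx1 : 2 / r ≤ 1 := by rw [div_le_one hr0]; linarith
  have hx0 : 0 ≤ 2 / r := by positivity
  have hVi2 : ‖V⁻¹ ^ 2‖ ≤ 2 / r := by
    rw [norm_pow]
    nlinarith [norm_nonneg V⁻¹]
  have hVi3' : ‖V⁻¹ ^ 3‖ ≤ (2 / r) ^ 3 := by
    rw [norm_pow]; exact pow_le_pow_left₀ (norm_nonneg _) hVi 3
  have hVi3 : ‖V⁻¹ ^ 3‖ ≤ 2 / r := hVi3'.trans (pow_le_of_le_one hx0 hx1 (by norm_num))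
  have t1 : ‖((S0 - 1 : ℝ) : ℂ) * V⁻¹‖ ≤ K / n ^ 2 * (2 / r) := by
    rw [norm_mul, Complex.norm_real, Real.norm_eq_abs]
    exact mul_le_mul s0 hVi (norm_nonneg _) (by positivity)
  have t2 : ‖(S1 : ℂ) * V⁻¹ ^ 2‖ ≤ K / n ^ 2 * (2 / r) := by
    rw [norm_mul, Complex.norm_real, Real.norm_eq_abs]
    exact mul_le_mul s1 hVi2 (norm_nonneg _) (by positivity)
  have t3 : ‖((S2 - β : ℝ) : ℂ) * V⁻¹ ^ 3‖ ≤ K / n ^ 2 * (2 / r) := by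
    rw [norm_mul, Complex.norm_real, Real.norm_eq_abs]
    exact mul_le_mul s2 hVi3 (norm_nonneg _) (by positivity)
  have t4 : ‖R * V⁻¹ ^ 3‖ ≤ (K + 2) / (2 * r) * (2 / r) ^ 3 := by
    rw [norm_mul]
    exact mul_le_mul hRb hVi3' (norm_nonneg _) (by positivity)
  have t5 := norm_add_le_of_le (norm_add_le_of_le (norm_add_le_of_le t1 t2) t3) t4
  have hn1 : ‖((n - 1 : ℝ) : ℂ)‖ ≤ n := by
    rw [Complex.norm_real, Real.norm_eq_abs, abs_of_pos (by linarith)]; linarith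
  refine (mul_le_mul hn1 t5 (norm_nonneg _) hn0.le).trans ?_
  have : n * (K / n ^ 2 * (2 / r) + K / n ^ 2 * (2 / r) + K / n ^ 2 * (2 / r) + (K + 2) / (2 * r) * (2 / r) ^ 3)
      = (6 * K / r + 4 * (K + 2)) / n := by
    rw [hn]; field_simp; ring
  rw [this]
  apply div_le_div_of_nonneg_right _ hn0.le
  have : 6 * K / r ≤ 6 * K := div_le_self (by positivity) hr
  linarith


theorem rescale_cauchy (n : ℕ) (hn : 1 ≤ n) (ν : Measure ℝ) (w : ℂ) (hw : 0 < w.im) :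
    cauchy (rescale n ν) w = (Real.sqrt n : ℂ) * cauchy ν ((Real.sqrt n : ℂ) * w) := by
  have hr : 0 < Real.sqrt n := Real.sqrt_pos.2 (by exact_mod_cast hn)
  have hrC : (Real.sqrt n : ℂ) ≠ 0 := by exact_mod_cast hr.ne'
  unfold cauchy rescale
  rw [integral_map (by fun_prop) (st_meas _ w), ← integral_const_mul]
  congr 1; ext u
  have : ((Real.sqrt n : ℂ) * w - u) = (Real.sqrt n : ℂ) * (w - ((u / Real.sqrt n : ℝ) : ℂ)) := by
    push_cast; field_simp
  rw [this, mul_inv, ← mul_assoc, mul_inv_cancel₀ hrC, one_mul]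

theorem inversion (m : Measure ℝ) [IsProbabilityMeasure m] (p : ℝ → ℝ) (h : HasDensity m p) (x : ℝ) :
    Tendsto (fun c : ℝ => (cauchy m ((x : ℂ) + ((1 / c : ℝ) : ℂ) * I)).im) atTop (𝓝 (-(Real.pi * p x))) := by
  obtain ⟨hc, hp0, hm⟩ := h
  have hpm : Measurable p := hc.measurable
  have hpi : Integrable p := by
    refine ⟨hpm.aestronglyMeasurable, ?_⟩
    rw [hasFiniteIntegral_iff_ofReal (Eventually.of_forall hp0)]
    have : m univ = ∫⁻ u, ENNReal.ofReal (p u) := by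
      rw [hm, withDensity_apply _ MeasurableSet.univ, Measure.restrict_univ]
    rw [← this]; exact measure_lt_top m _
  have hφ : ∫ s : ℝ, Real.pi⁻¹ * (1 + s ^ 2)⁻¹ = 1 := by
    rw [integral_const_mul, integral_univ_inv_one_add_sq, inv_mul_cancel₀ Real.pi_ne_zero]
  have hdec : Tendsto (fun s : ℝ => ‖s‖ ^ (Module.finrank ℝ ℝ) * (Real.pi⁻¹ * (1 + s ^ 2)⁻¹))
      (Bornology.cobounded ℝ) (𝓝 0) := by
    have h1 : Tendsto (fun s : ℝ => Real.pi⁻¹ / ‖s‖) (Bornology.cobounded ℝ) (𝓝 0) :=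
      Tendsto.const_div_atTop tendsto_norm_cobounded_atTop _
    apply squeeze_zero_norm' _ h1
    have h2 : ∀ᶠ s : ℝ in Bornology.cobounded ℝ, 1 ≤ ‖s‖ :=
      tendsto_norm_cobounded_atTop.eventually_ge_atTop 1
    filter_upwards [h2] with s hs
    have hpi0 := Real.pi_pos
    rw [Module.finrank_self, pow_one, Real.norm_eq_abs s, Real.norm_eq_abs, abs_of_nonneg (by positivity)]
    rw [Real.norm_eq_abs] at hs
    rw [le_div_iff₀ (by linarith)]
    have : |s| * (Real.pi⁻¹ * (1 + s ^ 2)⁻¹) * |s| = Real.pi⁻¹ * (s ^ 2 / (1 + s ^ 2)) := by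
      rw [← sq_abs s]; field_simp
    rw [this]
    apply mul_le_of_le_one_right (by positivity)
    rw [div_le_one (by positivity)]; linarith
  have key := tendsto_integral_comp_smul_smul_of_integrable' (μ := (volume : Measure ℝ))
    (φ := fun s : ℝ => Real.pi⁻¹ * (1 + s ^ 2)⁻¹) (fun s => by have := Real.pi_pos; positivity) hφ hdec
    (x₀ := x) hpi hc.continuousAt
  have key2 := key.const_mul (-Real.pi)
  rw [neg_mul] at key2
  refine key2.congr' ?_
  filter_upwards [eventually_gt_atTop 0] with c hc0
  have hy : 0 < ((x : ℂ) + ((1 / c : ℝ) : ℂ) * I).im := by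
    simp only [Complex.add_im, Complex.ofReal_im, Complex.re_ofReal_mul, Complex.im_ofReal_mul, Complex.I_im]
    rw [zero_add, mul_one]; positivity
  rw [cauchy_im m _ hy, hm, integral_withDensity_eq_integral_toReal_smul (by fun_prop) (by simp)]
  rw [← integral_const_mul, ← integral_const_mul]
  congr 1; ext u
  have e1 : ‖(x : ℂ) + ((1 / c : ℝ) : ℂ) * I - (u : ℂ)‖ ^ 2 = (x - u) ^ 2 + (1 / c) ^ 2 := by
    rw [← Complex.normSq_eq_norm_sq, Complex.normSq_apply]
    simp only [Complex.add_im, Complex.add_re, Complex.sub_re, Complex.sub_im, Complex.ofReal_im, Complex.ofReal_re, Complex.re_ofReal_mul, Complex.im_ofReal_mul, Complex.I_im, Complex.I_re]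
    ring
  rw [e1, ENNReal.toReal_ofReal (hp0 u)]
  simp only [Complex.add_im, Complex.ofReal_im, Complex.im_ofReal_mul, Complex.I_im, Module.finrank_self, pow_one, smul_eq_mul]
  have := Real.pi_ne_zero
  have h5 : (x - u) ^ 2 + (1 / c) ^ 2 ≠ 0 := by positivity
  have h6 : 1 + (c * (x - u)) ^ 2 ≠ 0 := by positivity
  have h7 : 1 + c ^ 2 * (x - u) ^ 2 ≠ 0 := by positivity
  have h8 : c ^ 2 * (x - u) ^ 2 + 1 ≠ 0 := by positivity
  field_simp
  ring

theorem core5 (σ : Measure ℝ) [IsFiniteMeasure σ] (α β K r : ℝ) (hβ : 0 ≤ β) (hK : 0 ≤ K)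
    (hr : 1 ≤ r) (hr2 : 100 * (1 + K + β) ≤ r ^ 2)
    (hi : ∀ k ≤ 6, Integrable (fun u : ℝ => (u - α) ^ k) σ)
    (s0 : |∫ u : ℝ, (u - α) ^ 0 ∂σ - 1| ≤ K / r ^ 4)
    (s1 : |∫ u : ℝ, (u - α) ^ 1 ∂σ| ≤ K / r ^ 4)
    (s2 : |∫ u : ℝ, (u - α) ^ 2 ∂σ - β| ≤ K / r ^ 4)
    (s6 : ∫ u : ℝ, (u - α) ^ 6 ∂σ ≤ K)
    (x y e : ℝ) (hy : 0 < y)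
    (he : e = (1 - β * (1 / r ^ 2)) / Real.sqrt (1 - (β + 1) * (1 / r ^ 2)))
    (hζ : |e * (x - α / r)| < 2)
    (hδ : (2 * (10 * K + 8) + 200 * (β + 1) ^ 2) / r ^ 3 + 2 * y ≤ 1)
    (Z : ℂ) (hZ : 0 < Z.im)
    (h : (r : ℂ) * (x + y * I) = Z + ((r ^ 2 - 1 : ℝ) : ℂ) * cauchy σ Z) :
    1 / 2 ≤ ‖(Z - α) / r‖ ∧
    ‖((e : ℂ) * ((Z - α) / r) - (β * (1 / r ^ 2) : ℝ) / ((Z - α) / r))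
      - (((e * (x - α / r)) / 2 : ℝ) + (Real.sqrt (4 - (e * (x - α / r)) ^ 2) / 2 : ℝ) * I)‖
      ≤ 8 * ((2 * (10 * K + 8) + 200 * (β + 1) ^ 2) / r ^ 3 + 2 * y)
        / Real.sqrt (4 - (e * (x - α / r)) ^ 2) := by
  have hr0 : 0 < r := by linarith
  have hrC : (r : ℂ) ≠ 0 := by exact_mod_cast hr0.ne'
  have hz : 0 < ((r : ℂ) * (x + y * I)).im := by
    simp only [Complex.im_ofReal_mul, Complex.add_im, Complex.ofReal_im, Complex.I_im]
    rw [zero_add, mul_one]; positivity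
  obtain ⟨hV, hE⟩ := core1 σ α β K r hβ hK hr hr2 hi s0 s1 s2 s6 _ Z hz hZ h
  have hε : 0 < 1 / r ^ 2 := by positivity
  have hκ : (β + 1) * (1 / r ^ 2) ≤ 1 / 100 := by
    rw [mul_one_div, div_le_div_iff₀ (by positivity) (by norm_num)]
    linarith
  have hv2 : 1 / 2 ≤ ‖(Z - α) / r‖ := by
    rw [norm_div, Complex.norm_real, Real.norm_eq_abs, abs_of_pos hr0, le_div_iff₀ hr0]
    linarith
  have hv : 0 < ((Z - α) / r).im := by
    rw [Complex.div_ofReal_im]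
    simp; positivity
  refine ⟨hv2, ?_⟩
  obtain ⟨hWim, hW⟩ := core2 β (1 / r ^ 2) hβ hε hκ e he _ hv hv2
  obtain ⟨el, eu, -, -⟩ := e_facts β (1 / r ^ 2) hβ hε hκ e he
  refine core3 _ _ hζ hδ _ hWim ?_
  have hV0 : (Z - α) ≠ 0 := by
    intro h; rw [h] at hV; simp at hV; linarith
  generalize hvdef : (Z - α) / (r : ℂ) = v at *
  have hv0 : v ≠ 0 := by intro h; rw [h] at hv2; norm_num at hv2
  have hZv : Z - α = r * v := by rw [← hvdef]; field_simp
  rw [hZv] at hE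
  have hE2 : ‖((x : ℂ) + y * I - (α / r : ℝ)) - (v + (1 - 1 / r ^ 2 : ℝ) / v + (1 - 1 / r ^ 2 : ℝ) * (β * (1 / r ^ 2) : ℝ) / v ^ 3)‖
      ≤ (10 * K + 8) / r ^ 3 := by
    have : (r : ℂ) * (x + y * I) - α - (r * v + (r ^ 2 - 1 : ℝ) / (r * v) + (r ^ 2 - 1 : ℝ) * β / (r * v) ^ 3)
      = r * (((x : ℂ) + y * I - (α / r : ℝ)) - (v + (1 - 1 / r ^ 2 : ℝ) / v + (1 - 1 / r ^ 2 : ℝ) * (β * (1 / r ^ 2) : ℝ) / v ^ 3)) := by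
      push_cast
      field_simp
    rw [this, norm_mul, Complex.norm_real, Real.norm_eq_abs, abs_of_pos hr0] at hE
    rw [show (10 * K + 8) / r ^ 3 = (10 * K + 8) / r ^ 2 / r by field_simp, le_div_iff₀ hr0]
    linarith
  generalize (v + (1 - 1 / r ^ 2 : ℝ) / v + (1 - 1 / r ^ 2 : ℝ) * (β * (1 / r ^ 2) : ℝ) / v ^ 3) = T at *
  generalize ((e : ℂ) * v - (β * (1 / r ^ 2) : ℝ) / v) = W at *
  have split : W + 1 / W - (e * (x - α / r) : ℝ) = (W + 1 / W - e * T)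
      - e * (((x : ℂ) + y * I - (α / r : ℝ)) - T) + e * (y * I) := by
    push_cast; ring
  rw [split]
  have t2 : ‖(e : ℂ) * (((x : ℂ) + y * I - (α / r : ℝ)) - T)‖ ≤ 2 * ((10 * K + 8) / r ^ 3) := by
    rw [norm_mul, Complex.norm_real, Real.norm_eq_abs, abs_of_pos (by linarith)]
    exact mul_le_mul (by linarith) hE2 (norm_nonneg _) (by norm_num)
  have t3 : ‖(e : ℂ) * (y * I)‖ ≤ 2 * y := by
    rw [norm_mul, norm_mul, Complex.norm_I, Complex.norm_real, Complex.norm_real, Real.norm_eq_abs, Real.norm_eq_abs,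
      abs_of_pos (by linarith), abs_of_pos hy, mul_one]
    exact mul_le_mul_of_nonneg_right (by linarith) hy.le
  refine (norm_add_le_of_le (norm_sub_le_of_le hW t2) t3).trans ?_
  have t4 : 200 * ((β + 1) * (1 / r ^ 2)) ^ 2 ≤ 200 * (β + 1) ^ 2 / r ^ 3 := by
    rw [mul_one_div, div_pow, mul_div_assoc']
    apply div_le_div_of_nonneg_left (by positivity) (by positivity)
    rw [← pow_mul]
    exact pow_le_pow_right₀ hr (by norm_num)
  have t5 : (2 * (10 * K + 8) + 200 * (β + 1) ^ 2) / r ^ 3 = 2 * ((10 * K + 8) / r ^ 3) + 200 * (β + 1) ^ 2 / r ^ 3 := by ring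
  rw [t5]
  linarith

theorem trunc (τ : Measure ℝ) [IsProbabilityMeasure τ] (α r : ℝ) (T : Set ℝ) (hT : MeasurableSet T)
    (hr : 8 ≤ r) (hTc : ∀ u, u ∉ T → r / 8 ≤ |u - α|)
    (hi : ∀ k ≤ 6, Integrable (fun u : ℝ => (u - α) ^ k) τ) (k : ℕ) (hk : k ≤ 2) :
    |∫ u in T, (u - α) ^ k ∂τ - ∫ u, (u - α) ^ k ∂τ| ≤ (4096 * ∫ u, (u - α) ^ 6 ∂τ) / r ^ 4 := by
  have h := integral_add_compl hT (hi k (by omega))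
  have e : ∫ u in T, (u - α) ^ k ∂τ - ∫ u, (u - α) ^ k ∂τ = - ∫ u in Tᶜ, (u - α) ^ k ∂τ := by linarith
  rw [e, abs_neg, ← Real.norm_eq_abs]
  have hr0 : 0 < r := by linarith
  have j : Integrable (fun u : ℝ => 4096 / r ^ 4 * (u - α) ^ 6) τ := (hi 6 le_rfl).const_mul _
  have h1 : ‖∫ u in Tᶜ, (u - α) ^ k ∂τ‖ ≤ ∫ u in Tᶜ, 4096 / r ^ 4 * (u - α) ^ 6 ∂τ := by
    apply norm_integral_le_of_norm_le j.restrict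
    filter_upwards [ae_restrict_mem hT.compl] with u hu
    have hu := hTc u hu
    rw [norm_pow, Real.norm_eq_abs]
    have h1 : 1 ≤ |u - α| := by linarith
    have h2 : |u - α| ^ k ≤ |u - α| ^ 2 := pow_le_pow_right₀ h1 hk
    have e6 : (u - α) ^ 6 = |u - α| ^ 4 * |u - α| ^ 2 := by
      rw [← pow_add]; exact (Even.pow_abs (by decide) _).symm
    have h3 : (r / 8) ^ 4 ≤ |u - α| ^ 4 := pow_le_pow_left₀ (by positivity) hu 4
    have h4 : 1 ≤ 4096 / r ^ 4 * |u - α| ^ 4 := by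
      rw [div_mul_eq_mul_div, le_div_iff₀ (by positivity)]
      rw [div_pow] at h3
      linarith
    rw [e6, ← mul_assoc]
    have := mul_le_mul_of_nonneg_right h4 (sq_nonneg |u - α|)
    linarith
  refine h1.trans ?_
  have h2 : ∫ u in Tᶜ, 4096 / r ^ 4 * (u - α) ^ 6 ∂τ ≤ ∫ u, 4096 / r ^ 4 * (u - α) ^ 6 ∂τ :=
    setIntegral_le_integral j (Eventually.of_forall fun u => by
      have : (0 : ℝ) ≤ (u - α) ^ 6 := Even.pow_nonneg (by decide) _
      positivity)
  refine h2.trans (le_of_eq ?_)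
  rw [integral_const_mul]; ring

theorem core6 (r x y α : ℝ) (hr : 10 ≤ r) (hα : |α| ≤ r / 4) (hx : |x| ≤ 4) (hy : 0 < y) (hy1 : y ≤ 1)
    (Z Z' : ℂ) (h : r / 2 ≤ ‖Z - α‖) (h' : r / 2 ≤ ‖Z' - α‖) (hr2 : 48 ≤ r ^ 2) :
    ‖(r : ℂ) * ((r ^ 2 - 1 : ℝ) / ((r ^ 2 : ℝ) * Z - (r : ℂ) * (x + y * I)))
      - (r : ℂ) * ((r ^ 2 - 1 : ℝ) / ((r ^ 2 : ℝ) * Z' - (r : ℂ) * (x + y * I)))‖ ≤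
      64 * ‖(Z - α) / r - (Z' - α) / r‖ := by
  have hr0 : 0 < r := by linarith
  have hrC : (r : ℂ) ≠ 0 := by exact_mod_cast hr0.ne'
  have low : ∀ Z : ℂ, r / 2 ≤ ‖Z - α‖ → r ^ 3 / 8 ≤ ‖((r ^ 2 : ℝ) : ℂ) * Z - (r : ℂ) * (x + y * I)‖ := by
    intro Z h
    have h1 : r / 4 ≤ ‖Z‖ := by
      have := norm_sub_le Z (α : ℂ)
      rw [Complex.norm_real, Real.norm_eq_abs] at this
      linarith
    have h2 := norm_sub_norm_le (((r ^ 2 : ℝ) : ℂ) * Z) ((r : ℂ) * (x + y * I))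
    rw [norm_mul, norm_mul, Complex.norm_real, Complex.norm_real, Real.norm_eq_abs, Real.norm_eq_abs,
      abs_of_pos hr0, abs_of_pos (by positivity : 0 < r ^ 2)] at h2
    have h3 : ‖(x : ℂ) + y * I‖ ≤ 6 := by
      refine (norm_add_le _ _).trans ?_
      rw [norm_mul, Complex.norm_I, Complex.norm_real, Complex.norm_real, Real.norm_eq_abs, Real.norm_eq_abs, abs_of_pos hy]
      linarith
    have h4 : r ^ 2 * (r / 4) ≤ r ^ 2 * ‖Z‖ := mul_le_mul_of_nonneg_left h1 (by positivity)
    have h5 : r * ‖(x : ℂ) + y * I‖ ≤ r * 6 := mul_le_mul_of_nonneg_left h3 hr0.le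
    have h6 : r * 48 ≤ r * r ^ 2 := mul_le_mul_of_nonneg_left hr2 hr0.le
    have h7 : r * r ^ 2 = r ^ 3 := by ring
    have h8 : r ^ 2 * (r / 4) = r ^ 3 / 4 := by ring
    linarith
  have l := low Z h
  have l' := low Z' h'
  have hp : 0 < r ^ 3 / 8 := by positivity
  set D := ((r ^ 2 : ℝ) : ℂ) * Z - (r : ℂ) * (x + y * I) with hD
  set D' := ((r ^ 2 : ℝ) : ℂ) * Z' - (r : ℂ) * (x + y * I) with hD'
  have hD0 : D ≠ 0 := by intro h; rw [h] at l; simp at l; linarith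
  have hD0' : D' ≠ 0 := by intro h; rw [h] at l'; simp at l'; linarith
  have hdd : D' - D = -((r ^ 3 : ℝ) : ℂ) * ((Z - α) / r - (Z' - α) / r) := by
    rw [hD, hD']; push_cast; field_simp; ring
  have e : (r : ℂ) * ((r ^ 2 - 1 : ℝ) / D) - (r : ℂ) * ((r ^ 2 - 1 : ℝ) / D') =
      ((r * (r ^ 2 - 1) : ℝ) : ℂ) * (D' - D) / (D * D') := by
    push_cast; field_simp
  rw [e, hdd, norm_div, norm_mul, norm_mul, norm_mul, norm_neg, Complex.norm_real, Complex.norm_real,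
    Real.norm_eq_abs, Real.norm_eq_abs, abs_of_pos (by positivity : 0 < r ^ 3),
    abs_of_pos (mul_pos hr0 (by linarith)), div_le_iff₀ (mul_pos (norm_pos_iff.2 hD0) (norm_pos_iff.2 hD0'))]
  have hm : r ^ 3 / 8 * (r ^ 3 / 8) ≤ ‖D‖ * ‖D'‖ := mul_le_mul l l' hp.le (norm_nonneg _)
  have hq := norm_nonneg ((Z - α) / r - (Z' - α) / r)
  generalize ‖(Z - α) / r - (Z' - α) / r‖ = q at *
  have h1 : 64 * q * (r ^ 3 / 8 * (r ^ 3 / 8)) ≤ 64 * q * (‖D‖ * ‖D'‖) :=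
    mul_le_mul_of_nonneg_left hm (by positivity)
  have h2 : r * (r ^ 2 - 1) ≤ r ^ 3 := by nlinarith
  have h3 : r * (r ^ 2 - 1) * (r ^ 3 * q) ≤ r ^ 3 * (r ^ 3 * q) := mul_le_mul_of_nonneg_right h2 (by positivity)
  linarith


theorem cauchy_neg (σ : Measure ℝ) (z : ℂ) : ∫ u, ((u : ℂ) - z)⁻¹ ∂σ = - cauchy σ z := by
  unfold cauchy
  rw [← integral_neg]
  congr 1; ext u
  rw [← neg_sub, inv_neg]

theorem box_eqs (μ ν σ : Measure ℝ) (n : ℕ) (hn : 2 ≤ n) (Z : ℂ → ℂ) (h : IsBoxPow μ n Z ν)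
    (hσ : ∀ z : ℂ, 0 < z.im → recip μ z = z + ∫ u, ((u : ℂ) - z)⁻¹ ∂σ) (z : ℂ) (hz : 0 < z.im) :
    0 < (Z z).im ∧ z = Z z + ((n : ℂ) - 1) * cauchy σ (Z z) ∧
      cauchy ν z = ((n : ℂ) - 1) / ((n : ℂ) * Z z - z) := by
  obtain ⟨⟨⟨m, hm, hF⟩, hsub⟩, hν, hrec⟩ := h
  have hZ : 0 < (Z z).im := by rw [hF z hz]; exact recip_im_pos m z hz
  have h1 := hsub z hz
  have h2 := hσ (Z z) hZ
  rw [cauchy_neg] at h2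
  have hn1 : (n : ℂ) - 1 ≠ 0 := by
    rw [sub_ne_zero]; norm_cast; omega
  refine ⟨hZ, ?_, ?_⟩
  · rw [h2] at h1
    linear_combination h1
  · have h3 := hrec z hz
    have h4 : cauchy ν z = (recip ν z)⁻¹ := by unfold recip; rw [inv_inv]
    rw [h4, h3]
    have h5 : (n : ℂ) * Z z - z = ((n : ℂ) - 1) * recip μ (Z z) := by linear_combination -h1
    rw [h5, div_mul_eq_div_div, div_self hn1, one_div]

theorem core7 (σ σ' : Measure ℝ) [IsFiniteMeasure σ] [IsFiniteMeasure σ'] (α β K r : ℝ) (hβ : 0 ≤ β) (hK : 0 ≤ K)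
    (hr2 : 100 * (1 + K + β) ≤ r ^ 2) (hr : 10 ≤ r) (hα : |α| ≤ r / 4)
    (hi : ∀ k ≤ 6, Integrable (fun u : ℝ => (u - α) ^ k) σ)
    (s0 : |∫ u : ℝ, (u - α) ^ 0 ∂σ - 1| ≤ K / r ^ 4)
    (s1 : |∫ u : ℝ, (u - α) ^ 1 ∂σ| ≤ K / r ^ 4)
    (s2 : |∫ u : ℝ, (u - α) ^ 2 ∂σ - β| ≤ K / r ^ 4)
    (s6 : ∫ u : ℝ, (u - α) ^ 6 ∂σ ≤ K)
    (hi' : ∀ k ≤ 6, Integrable (fun u : ℝ => (u - α) ^ k) σ')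
    (s0' : |∫ u : ℝ, (u - α) ^ 0 ∂σ' - 1| ≤ K / r ^ 4)
    (s1' : |∫ u : ℝ, (u - α) ^ 1 ∂σ'| ≤ K / r ^ 4)
    (s2' : |∫ u : ℝ, (u - α) ^ 2 ∂σ' - β| ≤ K / r ^ 4)
    (s6' : ∫ u : ℝ, (u - α) ^ 6 ∂σ' ≤ K)
    (x e C : ℝ) (hC : C = 2 * (10 * K + 8) + 200 * (β + 1) ^ 2) (hCr : C / r ^ 3 ≤ 1 / 2)
    (he : e = (1 - β * (1 / r ^ 2)) / Real.sqrt (1 - (β + 1) * (1 / r ^ 2)))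
    (hζ : |e * (x - α / r)| < 2)
    (n : ℕ) (hn : 2 ≤ n) (hrn : r = Real.sqrt n)
    (μ μ' ν ν' : Measure ℝ) (Z Z' : ℂ → ℂ) (h : IsBoxPow μ n Z ν) (h' : IsBoxPow μ' n Z' ν')
    (hσ : ∀ z : ℂ, 0 < z.im → recip μ z = z + ∫ u, ((u : ℂ) - z)⁻¹ ∂σ)
    (hσ' : ∀ z : ℂ, 0 < z.im → recip μ' z = z + ∫ u, ((u : ℂ) - z)⁻¹ ∂σ')
    (p p' : ℝ → ℝ) (hp : HasDensity (rescale n ν) p) (hp' : HasDensity (rescale n ν') p') :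
    |p x - p' x| ≤ 2048 * C / r ^ 3 / Real.sqrt (4 - (e * (x - α / r)) ^ 2) := by
  have hr0 : 0 < r := by linarith
  have hε : 0 < 1 / r ^ 2 := by positivity
  have hκ : (β + 1) * (1 / r ^ 2) ≤ 1 / 100 := by
    rw [mul_one_div, div_le_div_iff₀ (by positivity) (by norm_num)]
    linarith
  obtain ⟨el, eu, -, -⟩ := e_facts β (1 / r ^ 2) hβ hε hκ e he
  have hx : |x| ≤ 4 := by
    rw [abs_mul, abs_of_pos (by linarith)] at hζ
    have h1 : |x - α / r| ≤ 3 := by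
      by_contra hh
      push Not at hh
      nlinarith
    have h2 : |α / r| ≤ 1 / 4 := by
      rw [abs_div, abs_of_pos hr0, div_le_iff₀ hr0]; linarith
    have h3 := abs_add_le (x - α / r) (α / r)
    rw [sub_add_cancel] at h3
    linarith
  set s := Real.sqrt (4 - (e * (x - α / r)) ^ 2) with hs
  have hs0 : 0 < s := by
    apply Real.sqrt_pos.2
    have := sq_lt_sq' (by linarith [neg_lt_of_abs_lt hζ]) (lt_of_abs_lt hζ)
    linarith
  have hnr : (n : ℝ) = r ^ 2 := by rw [hrn, Real.sq_sqrt (Nat.cast_nonneg _)]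
  have hnC : (n : ℂ) = ((r ^ 2 : ℝ) : ℂ) := by rw [← hnr]; simp
  have hnC1 : (n : ℂ) - 1 = ((r ^ 2 - 1 : ℝ) : ℂ) := by rw [hnC]; push_cast; ring
  have main : ∀ y : ℝ, 0 < y → y ≤ 1 / 4 →
      |(cauchy (rescale n ν) ((x : ℂ) + (y : ℂ) * I)).im - (cauchy (rescale n ν') ((x : ℂ) + (y : ℂ) * I)).im|
        ≤ 2048 * (C / r ^ 3 + 2 * y) / s := by
    intro y hy hy1
    have hδ : C / r ^ 3 + 2 * y ≤ 1 := by linarith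
    have hz0 : 0 < ((x : ℂ) + (y : ℂ) * I).im := by simpa using hy
    have hz : 0 < ((r : ℂ) * ((x : ℂ) + (y : ℂ) * I)).im := by
      rw [Complex.im_ofReal_mul]; positivity
    obtain ⟨a1, a2, a3⟩ := box_eqs μ ν σ n hn Z h hσ _ hz
    obtain ⟨b1, b2, b3⟩ := box_eqs μ' ν' σ' n hn Z' h' hσ' _ hz
    rw [hnC1] at a2 a3 b2 b3
    rw [hnC] at a3 b3
    rw [rescale_cauchy n (by omega) ν _ hz0, rescale_cauchy n (by omega) ν' _ hz0, ← hrn, a3, b3]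
    generalize Z ((r : ℂ) * ((x : ℂ) + (y : ℂ) * I)) = A at *
    generalize Z' ((r : ℂ) * ((x : ℂ) + (y : ℂ) * I)) = B at *
    rw [hC] at hδ
    obtain ⟨va, wa⟩ := core5 σ α β K r hβ hK (by linarith) hr2 hi s0 s1 s2 s6 x y e hy he hζ hδ A a1 a2
    obtain ⟨vb, wb⟩ := core5 σ' α β K r hβ hK (by linarith) hr2 hi' s0' s1' s2' s6' x y e hy he hζ hδ B b1 b2
    rw [← hC, ← hs] at wa wb
    have low : ∀ A : ℂ, 1 / 2 ≤ ‖(A - α) / r‖ → r / 2 ≤ ‖A - α‖ := by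
      intro A hA
      rw [norm_div, Complex.norm_real, Real.norm_eq_abs, abs_of_pos hr0, le_div_iff₀ hr0] at hA
      linarith
    have c6 := core6 r x y α hr hα hx hy (by linarith) A B (low A va) (low B vb) (by nlinarith)
    have hb2 : β * (1 / r ^ 2) ≤ 1 / 100 := by linarith
    have c4 := core4 e (β * (1 / r ^ 2)) (by positivity) hb2 el _ _ va vb
    rw [← Complex.sub_im]
    refine (Complex.abs_im_le_norm _).trans (c6.trans ?_)
    have tri := dist_triangle_right
      ((e : ℂ) * ((A - α) / r) - (β * (1 / r ^ 2) : ℝ) / ((A - α) / r))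
      ((e : ℂ) * ((B - α) / r) - (β * (1 / r ^ 2) : ℝ) / ((B - α) / r))
      (((e * (x - α / r)) / 2 : ℝ) + (s / 2 : ℝ) * I)
    rw [dist_eq_norm, dist_eq_norm, dist_eq_norm] at tri
    have : 2048 * (C / r ^ 3 + 2 * y) / s = 64 * (2 * (8 * (C / r ^ 3 + 2 * y) / s + 8 * (C / r ^ 3 + 2 * y) / s)) := by
      ring
    rw [this]
    linarith
  obtain ⟨-, hνP, -⟩ := h
  obtain ⟨-, hνP', -⟩ := h'
  have : IsProbabilityMeasure (rescale n ν) := Measure.isProbabilityMeasure_map (by fun_prop)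
  have : IsProbabilityMeasure (rescale n ν') := Measure.isProbabilityMeasure_map (by fun_prop)
  have i1 := inversion (rescale n ν) p hp x
  have i2 := inversion (rescale n ν') p' hp' x
  have i3 := (i1.sub i2).abs
  have i4 : Tendsto (fun c : ℝ => 2048 * (C / r ^ 3 + 2 * (1 / c)) / s) atTop (𝓝 (2048 * (C / r ^ 3 + 2 * 0) / s)) := by
    have : Tendsto (fun c : ℝ => 1 / c) atTop (𝓝 0) := by
      simpa using tendsto_inv_atTop_zero (𝕜 := ℝ)
    exact (((this.const_mul 2).const_add _).const_mul _).div_const _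
  have i5 := le_of_tendsto_of_tendsto i3 i4 (by
    filter_upwards [eventually_ge_atTop 4] with c hc
    refine main (1 / c) (by positivity) ?_
    exact one_div_le_one_div_of_le (by norm_num) hc)
  have e1 : -(Real.pi * p x) - -(Real.pi * p' x) = -(Real.pi * (p x - p' x)) := by ring
  rw [e1, abs_neg, abs_mul, abs_of_pos Real.pi_pos] at i5
  have hpi := Real.pi_gt_three
  have h0 := abs_nonneg (p x - p' x)
  have e2 : 2048 * C / r ^ 3 / s = 2048 * (C / r ^ 3 + 2 * 0) / s := by ring
  rw [e2]
  nlinarith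

theorem shifted_int (τ : Measure ℝ) [IsFiniteMeasure τ] (h6 : Integrable (fun u => u ^ 6) τ) (α : ℝ) :
    ∀ k ≤ 6, Integrable (fun u : ℝ => (u - α) ^ k) τ := by
  have h6' : Integrable (fun u : ℝ => |u| ^ 6) τ := by
    convert h6 using 2 with u
    exact Even.pow_abs (by decide) _
  have hp := pow_int h6'
  intro k hk
  have : (fun u : ℝ => (u - α) ^ k) = fun u => ∑ m ∈ Finset.range (k + 1), u ^ m * (-α) ^ (k - m) * (k.choose m) := by
    ext u; rw [sub_eq_add_neg, add_pow]
  rw [this]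
  refine integrable_finsetSum _ fun m hm => ?_
  rw [Finset.mem_range] at hm
  exact ((hp m (by omega)).mul_const _).mul_const _


theorem trunc_low (n : ℕ) (r α : ℝ) (hnr : (n : ℝ) = r ^ 2) (hr10 : 10 ≤ r) (hα8 : |α| ≤ r / 8)
    (u : ℝ) (hu : u ∉ truncSet n) : r / 8 ≤ |u - α| := by
  have hu : Real.sqrt ((n : ℝ) - 1) / Real.pi < |u| := by
    unfold truncSet at hu
    simpa using hu
  have q1 : 9 / 10 * r ≤ Real.sqrt ((n : ℝ) - 1) := by
    apply Real.le_sqrt_of_sq_le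
    rw [hnr]; nlinarith
  have q2 : r / 4 ≤ Real.sqrt ((n : ℝ) - 1) / Real.pi := by
    rw [le_div_iff₀ Real.pi_pos]
    have := Real.pi_lt_d2
    nlinarith
  have q3 := abs_sub_abs_le_abs_sub u α
  linarith

theorem stmt_14
    (μ : Measure ℝ) [IsProbabilityMeasure μ]
    (h8 : Integrable (fun u => u ^ 8) μ)
    (h1 : mom μ 1 = 0) (h2 : mom μ 2 = 1)
    (τ : Measure ℝ) [IsProbabilityMeasure τ]
    (hτ : ∀ z : ℂ, 0 < z.im → recip μ z = z + ∫ u, ((u : ℂ) - z)⁻¹ ∂τ)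
    (μs : ℕ → Measure ℝ) (hμsP : ∀ n : ℕ, IsProbabilityMeasure (μs n))
    (hμs : ∀ n : ℕ, ∀ z : ℂ, 0 < z.im →
      recip (μs n) z = z + ∫ u in truncSet n, ((u : ℂ) - z)⁻¹ ∂τ)
    (W : ℕ → ℂ → ℂ) (νs : ℕ → Measure ℝ)
    (hboxW : ∀ n : ℕ, 1 ≤ n → IsBoxPow (μs n) n (W n) (νs n))
    (hnotdirac : ¬ ∃ c : ℝ, μ = Measure.dirac c)
    (Z : ℕ → ℂ → ℂ) (ν : ℕ → Measure ℝ)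
    (hbox : ∀ n : ℕ, 1 ≤ n → IsBoxPow μ n (Z n) (ν n))
    (p : ℕ → ℝ → ℝ)
    (hp : ∀ᶠ n in atTop, HasDensity (rescale n (ν n)) (p n))
    (ps : ℕ → ℝ → ℝ)
    (hps : ∀ᶠ n in atTop, HasDensity (rescale n (νs n)) (ps n)) :
    ∃ c₁ : ℝ, 0 < c₁ ∧ ∃ c : ℝ, 0 < c ∧ ∃ n₁ : ℕ, ∀ n : ℕ, n₁ ≤ n →
      ∃ θ ρ : ℝ → ℝ,
        ContinuousOn ρ {x : ℝ | |x - aQ μ n| ≤ 2 / eQ μ n - c₁ * (n : ℝ) ^ (-(6 / 5) : ℝ)} ∧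
        (∀ x : ℝ, |x - aQ μ n| ≤ 2 / eQ μ n - c₁ * (n : ℝ) ^ (-(6 / 5) : ℝ) →
          |θ x| ≤ 1 ∧ 0 ≤ ρ x ∧ ρ x ≤ c ∧
          p n x = ps n x
            + θ x * c / ((n : ℝ) ^ ((6 : ℝ) / 5) *
                Real.sqrt (4 - (eQ μ n * (x - aQ μ n)) ^ 2))
            + ρ x) ∧
        (∫ x in {x : ℝ | |x - aQ μ n| ≤ 2 / eQ μ n - c₁ * (n : ℝ) ^ (-(6 / 5) : ℝ)}, ρ x)
          ≤ c * (n : ℝ) ^ (-(4 : ℝ)) := by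
  obtain ⟨h6, hm1, hm2⟩ := tau_moments μ h8 h1 h2 τ hτ
  set α := mom μ 3 with hαd
  set β := mom μ 4 - α ^ 2 - 1 with hβd
  have hi := shifted_int τ h6 α
  have h6a : Integrable (fun u : ℝ => |u| ^ 6) τ := by
    convert h6 using 2 with u
    exact Even.pow_abs (by decide) _
  have hq := pow_int h6a
  have j1 : Integrable (fun u : ℝ => u) τ := by simpa using hq 1 (by norm_num)
  have j2 : Integrable (fun u : ℝ => u ^ 2) τ := hq 2 (by norm_num)
  have i0 : ∫ u : ℝ, (u - α) ^ 0 ∂τ = 1 := by simp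
  have i1 : ∫ u : ℝ, (u - α) ^ 1 ∂τ = 0 := by
    simp only [pow_one]
    rw [integral_sub j1 (integrable_const _), hm1]
    simp
  have i2 : ∫ u : ℝ, (u - α) ^ 2 ∂τ = β := by
    have : (fun u : ℝ => (u - α) ^ 2) = fun u => (u ^ 2 - 2 * α * u) + α ^ 2 := by
      ext u; ring
    rw [this, integral_add (f := fun u : ℝ => u ^ 2 - 2 * α * u) (j2.sub (j1.const_mul (2 * α))) (integrable_const _),
      integral_sub j2 (j1.const_mul (2 * α)), integral_const_mul, hm1, hm2]
    simp only [integral_const, probReal_univ, one_smul]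
    rw [hβd]; ring
  have hβ : 0 ≤ β := by
    rw [← i2]; exact integral_nonneg fun u => sq_nonneg _
  have h6n : 0 ≤ ∫ u : ℝ, (u - α) ^ 6 ∂τ := integral_nonneg fun u => Even.pow_nonneg (by decide) _
  set K := 4096 * ∫ u : ℝ, (u - α) ^ 6 ∂τ with hKd
  have hK : 0 ≤ K := by positivity
  have hK6 : ∫ u : ℝ, (u - α) ^ 6 ∂τ ≤ K := by linarith
  obtain ⟨C, hC⟩ : ∃ C, C = 2 * (10 * K + 8) + 200 * (β + 1) ^ 2 := ⟨_, rfl⟩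
  have hC0 : 0 < C := by rw [hC]; positivity
  refine ⟨1, one_pos, 2048 * C, by positivity, ?_⟩
  have hR : ∀ᶠ n : ℕ in atTop, 10 + 8 * |α| + 100 * (1 + K + β) + 2 * C ≤ Real.sqrt n :=
    (Real.tendsto_sqrt_atTop.comp tendsto_natCast_atTop_atTop).eventually_ge_atTop _
  obtain ⟨n₁, hn₁⟩ := eventually_atTop.1 (hp.and (hps.and (hR.and (eventually_ge_atTop 2))))
  refine ⟨n₁, fun n hn => ?_⟩
  obtain ⟨hpn, hpsn, hRn, hn2⟩ := hn₁ n hn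
  obtain ⟨r, hrd⟩ : ∃ r, r = Real.sqrt n := ⟨_, rfl⟩
  rw [← hrd] at hRn
  have hα0 := abs_nonneg α
  have hC1 : 0 ≤ 100 * (1 + K + β) := by positivity
  have hr10 : 10 ≤ r := by linarith
  have hr0 : 0 < r := by linarith
  have hrr : r ≤ r ^ 2 := le_self_pow₀ (by linarith) (by norm_num)
  have hrrr : r ≤ r ^ 3 := le_self_pow₀ (by linarith) (by norm_num)
  have hα8 : |α| ≤ r / 8 := by linarith
  have hr2 : 100 * (1 + K + β) ≤ r ^ 2 := by linarith
  have hCr : C / r ^ 3 ≤ 1 / 2 := by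
    rw [div_le_div_iff₀ (by positivity) (by norm_num)]
    linarith
  have hnr : (n : ℝ) = r ^ 2 := by rw [hrd, Real.sq_sqrt (Nat.cast_nonneg _)]
  have hn0 : (0 : ℝ) < n := by rw [hnr]; positivity
  have ha : aQ μ n = α / r := by unfold aQ; rw [← hrd]
  have he : eQ μ n = (1 - β * (1 / r ^ 2)) / Real.sqrt (1 - (β + 1) * (1 / r ^ 2)) := by
    unfold eQ bQ dQ
    rw [hnr, hβd]
    congr 2
    · ring
    · rw [← hαd]; ring
  have hε : 0 < 1 / r ^ 2 := by positivity
  have hκ : (β + 1) * (1 / r ^ 2) ≤ 1 / 100 := by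
    rw [mul_one_div, div_le_div_iff₀ (by positivity) (by norm_num)]
    linarith
  obtain ⟨el, eu, -, -⟩ := e_facts β (1 / r ^ 2) hβ hε hκ _ he
  have hTm : MeasurableSet (truncSet n) := by
    unfold truncSet
    exact measurableSet_le (by fun_prop) measurable_const
  have hTc : ∀ u, u ∉ truncSet n → r / 8 ≤ |u - α| := by
    intro u hu
    exact trunc_low n r α hnr hr10 hα8 u hu
  have tr := trunc τ α r (truncSet n) hTm (by linarith) hTc hi
  have hKr : 0 ≤ K / r ^ 4 := by positivity
  have key : ∀ x : ℝ, |eQ μ n * (x - α / r)| < 2 → |p n x - ps n x| ≤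
      2048 * C / r ^ 3 / Real.sqrt (4 - (eQ μ n * (x - α / r)) ^ 2) := by
    intro x hx
    refine core7 τ (τ.restrict (truncSet n)) α β K r hβ hK hr2 hr10 (by linarith) hi
      (by rw [i0]; simpa using hKr) (by rw [i1]; simpa using hKr) (by rw [i2]; simpa using hKr) hK6
      (fun k hk => (hi k hk).restrict) ?_ ?_ ?_ ?_ x (eQ μ n) C hC hCr he hx n hn2 hrd μ (μs n) (ν n) (νs n)
      (Z n) (W n) (hbox n (by omega)) (hboxW n (by omega)) hτ (hμs n) (p n) (ps n) hpn hpsn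
    · have := tr 0 (by norm_num)
      rwa [i0] at this
    · have := tr 1 (by norm_num)
      rwa [i1, sub_zero] at this
    · have := tr 2 (by norm_num)
      rwa [i2] at this
    · refine (setIntegral_le_integral (hi 6 le_rfl) (Eventually.of_forall fun u => ?_)).trans hK6
      exact Even.pow_nonneg (by decide) _
  rw [ha]
  generalize hed : eQ μ n = e at *
  have hNpos : 0 < (n : ℝ) ^ (-(6 / 5) : ℝ) := Real.rpow_pos_of_pos hn0 _
  have hN6 : 0 < (n : ℝ) ^ ((6 : ℝ) / 5) := Real.rpow_pos_of_pos hn0 _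
  have hN3 : (n : ℝ) ^ ((6 : ℝ) / 5) ≤ r ^ 3 := by
    have q1 : (n : ℝ) ^ ((6 : ℝ) / 5) ≤ (n : ℝ) ^ ((3 : ℝ) / 2) := by
      apply Real.rpow_le_rpow_of_exponent_le _ (by norm_num)
      rw [hnr]; linarith
    refine q1.trans (le_of_eq ?_)
    rw [hnr, ← Real.rpow_natCast r 2, ← Real.rpow_mul hr0.le, ← Real.rpow_natCast r 3]
    norm_num
  refine ⟨fun x => (p n x - ps n x) * ((n : ℝ) ^ ((6 : ℝ) / 5) * Real.sqrt (4 - (e * (x - α / r)) ^ 2)) / (2048 * C),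
    fun _ => 0, continuousOn_const, ?_, ?_⟩
  · intro x hx
    have hζ : |e * (x - α / r)| < 2 := by
      rw [abs_mul, abs_of_pos (by linarith)]
      have : |x - α / r| < 2 / e := by linarith
      rw [lt_div_iff₀ (by linarith)] at this
      linarith
    have hs0 : 0 < Real.sqrt (4 - (e * (x - α / r)) ^ 2) := by
      apply Real.sqrt_pos.2
      have := sq_lt_sq' (by linarith [neg_lt_of_abs_lt hζ]) (lt_of_abs_lt hζ)
      linarith
    have hk := key x hζ
    refine ⟨?_, le_rfl, by positivity, ?_⟩
    · rw [abs_div, abs_mul, abs_of_pos (by positivity : 0 < 2048 * C), abs_of_pos (mul_pos hN6 hs0),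
        div_le_one (by positivity)]
      rw [le_div_iff₀ hs0, le_div_iff₀ (by positivity)] at hk
      refine le_trans ?_ hk
      have := mul_le_mul_of_nonneg_left hN3 (mul_nonneg (abs_nonneg (p n x - ps n x)) hs0.le)
      linarith
    · have hm : (n : ℝ) ^ ((6 : ℝ) / 5) * Real.sqrt (4 - (e * (x - α / r)) ^ 2) ≠ 0 := (mul_pos hN6 hs0).ne'
      have hc : 2048 * C ≠ 0 := by positivity
      show p n x = ps n x + (p n x - ps n x) * ((n : ℝ) ^ ((6 : ℝ) / 5) * Real.sqrt (4 - (e * (x - α / r)) ^ 2))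
        / (2048 * C) * (2048 * C) / ((n : ℝ) ^ ((6 : ℝ) / 5) * Real.sqrt (4 - (e * (x - α / r)) ^ 2)) + 0
      rw [div_mul_cancel₀ _ hc, mul_div_cancel_right₀ _ hm]
      ring
  · simp only [integral_zero]
    positivity

end FreeCLT
end
end

section
/- Let μ be a Borel probability measure on ℝ with m_8(μ) < ∞, m_1(μ) = 0 and m_2(μ) = 1, let τ be the measure with F_μ(z) = z + ∫_ℝ (u−z)^{-1} τ(du), and for n ∈ ℕ let μ* be the probability measure with F_{μ*}(z) = z + ∫_{|u|≤√(n−1)/π} (u−z)^{-1} τ(du). Then there exist c(μ) > 0 and n₁ = n₁(μ) ∈ ℕ such that for all n ≥ n₁: (i) μ*([−√(n−1)/3, √(n−1)/3]) = 1; (ii) m_1(μ*) = 0; (iii) m_2(μ) − m_2(μ*) = τ(ℝ ∖ [−√(n−1)/π, √(n−1)/π]) and 0 ≤ m_2(μ) − m_2(μ*) ≤ c(μ) n^{−3}; (iv) |m_j(μ) − m_j(μ*)| ≤ c(μ) n^{−3 + (j−2)/2} for j = 3, …, 8. -/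
open MeasureTheory Complex Filter Set
open scoped Topology

noncomputable section

namespace FreeCLT

lemma norm_ge_y (y u : ℝ) : y ≤ ‖I * (y : ℂ) - (u : ℂ)‖ := by
  have := Complex.abs_im_le_norm (I * (y : ℂ) - (u : ℂ))
  simp at this
  exact (le_abs_self y).trans this

lemma norm_ge_u (y u : ℝ) : |u| ≤ ‖I * (y : ℂ) - (u : ℂ)‖ := by
  have := Complex.abs_re_le_norm (I * (y : ℂ) - (u : ℂ))
  simpa using this

def gk (μ : Measure ℝ) (k : ℕ) (y : ℝ) : ℂ := ∫ u, (u : ℂ) ^ k / (I * (y : ℂ) - (u : ℂ)) ∂μ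

lemma gk_meas (k : ℕ) (y : ℝ) :
    Measurable (fun u : ℝ => (u : ℂ) ^ k / (I * (y : ℂ) - (u : ℂ))) := by
  fun_prop

lemma gk_int (μ : Measure ℝ) (k : ℕ) (h : Integrable (fun u : ℝ => u ^ k) μ) (y : ℝ) (hy : 0 < y) :
    Integrable (fun u : ℝ => (u : ℂ) ^ k / (I * (y : ℂ) - (u : ℂ))) μ := by
  refine Integrable.mono' (h.norm.div_const y) (gk_meas k y).aestronglyMeasurable
    (Eventually.of_forall fun u => ?_)
  rw [norm_div, norm_pow, Complex.norm_real, norm_pow]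
  have := norm_ge_y y u
  gcongr

lemma gk_succ (μ : Measure ℝ) (k : ℕ) (h : Integrable (fun u : ℝ => u ^ k) μ)
    (y : ℝ) (hy : 0 < y) :
    I * (y : ℂ) * gk μ k y = (mom μ k : ℂ) + gk μ (k + 1) y := by
  have hc : Integrable (fun u : ℝ => (u : ℂ) ^ k) μ := by
    have := h.ofReal (𝕜 := ℂ)
    simpa using this
  have hm : (mom μ k : ℂ) = ∫ u, (u : ℂ) ^ k ∂μ := by
    rw [mom, ← integral_complex_ofReal]
    simp
  have hne : ∀ u : ℝ, I * (y : ℂ) - (u : ℂ) ≠ 0 := fun u h0 => by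
    have := norm_ge_y y u
    rw [h0, norm_zero] at this
    linarith
  have key : gk μ (k + 1) y = I * (y : ℂ) * gk μ k y - ∫ u, (u : ℂ) ^ k ∂μ := by
    unfold gk
    rw [← integral_const_mul, ← integral_sub ((gk_int μ k h y hy).const_mul _) hc]
    congr 1
    ext u
    have := hne u
    field_simp
    ring
  rw [key, hm]; ring

lemma gk_tendsto (μ : Measure ℝ) (k : ℕ) (g : ℝ → ℝ) (hg : Integrable g μ)
    (hb : ∀ y : ℝ, 1 ≤ y → ∀ u : ℝ, ‖(u : ℂ) ^ k / (I * (y : ℂ) - (u : ℂ))‖ ≤ g u) :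
    Tendsto (gk μ k) atTop (𝓝 0) := by
  have : (0 : ℂ) = ∫ u : ℝ, (0 : ℂ) ∂μ := by simp
  rw [this]
  unfold gk
  refine tendsto_integral_filter_of_dominated_convergence g
    (Eventually.of_forall fun y => (gk_meas k y).aestronglyMeasurable) ?_ hg ?_
  · filter_upwards [eventually_ge_atTop 1] with y hy
    exact Eventually.of_forall (hb y hy)
  · refine Eventually.of_forall fun u => ?_
    refine squeeze_zero_norm' (a := fun y : ℝ => |u| ^ k / y) ?_
      (tendsto_const_nhds.div_atTop tendsto_id)
    filter_upwards [eventually_gt_atTop 0] with y hy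
    rw [norm_div, norm_pow, Complex.norm_real, Real.norm_eq_abs]
    have := norm_ge_y y u
    gcongr

lemma gk_tendsto0 (μ : Measure ℝ) (k : ℕ) (h : Integrable (fun u : ℝ => u ^ k) μ) :
    Tendsto (gk μ k) atTop (𝓝 0) := by
  refine gk_tendsto μ k _ h.norm fun y hy u => ?_
  rw [norm_div, norm_pow, Complex.norm_real, norm_pow]
  have := norm_ge_y y u
  exact div_le_self (by positivity) (by linarith)

lemma gk_tendsto1 (μ : Measure ℝ) (k : ℕ) (h : Integrable (fun u : ℝ => u ^ k) μ) :
    Tendsto (gk μ (k + 1)) atTop (𝓝 0) := by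
  refine gk_tendsto μ (k + 1) _ h.norm fun y hy u => ?_
  rw [norm_div, norm_pow, Complex.norm_real, norm_pow]
  have h1 := norm_ge_y y u
  have h2 := norm_ge_u y u
  rw [div_le_iff₀ (by linarith), pow_succ]
  rw [← Real.norm_eq_abs] at h2
  gcongr

lemma int_pow_le (μ : Measure ℝ) [IsFiniteMeasure μ] (K : ℕ) (h : Integrable (fun u : ℝ => u ^ K) μ)
    (k : ℕ) (hk : k ≤ K) : Integrable (fun u : ℝ => u ^ k) μ := by
  refine Integrable.mono' ((integrable_const (1 : ℝ)).add h.norm)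
    (by fun_prop) (Eventually.of_forall fun u => ?_)
  simp only [norm_pow, Pi.add_apply]
  rcases le_total ‖u‖ 1 with h1 | h1
  · have := pow_le_one₀ (n := k) (norm_nonneg u) h1
    have : 0 ≤ ‖u‖ ^ K := by positivity
    linarith
  · have := pow_le_pow_right₀ h1 hk
    linarith

lemma mom_rec (μ : Measure ℝ) [IsProbabilityMeasure μ] (σ : Measure ℝ) [IsFiniteMeasure σ]
    (h8 : Integrable (fun u : ℝ => u ^ 8) μ) (h6 : Integrable (fun u : ℝ => u ^ 6) σ)
    (hF : ∀ z : ℂ, 0 < z.im → recip μ z = z + ∫ u, ((u : ℂ) - z)⁻¹ ∂σ) :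
    ∀ k : ℕ, k ≤ 7 → mom μ (k + 1) = ∑ i ∈ Finset.range k, mom σ i * mom μ (k - 1 - i) := by
  have iμ := int_pow_le μ 8 h8
  have iσ := int_pow_le σ 6 h6
  have tμ : ∀ k ≤ 9, Tendsto (gk μ k) atTop (𝓝 0) := by
    intro k hk
    rcases k with _ | k
    · exact gk_tendsto0 μ 0 (iμ 0 (by norm_num))
    · exact gk_tendsto1 μ k (iμ k (by omega))
  have tσ : ∀ k ≤ 7, Tendsto (gk σ k) atTop (𝓝 0) := by
    intro k hk
    rcases k with _ | k
    · exact gk_tendsto0 σ 0 (iσ 0 (by norm_num))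
    · exact gk_tendsto1 σ k (iσ k (by omega))
  have m0 : mom μ 0 = 1 := by simp [mom]
  have tz : Tendsto (fun y : ℝ => I * (y : ℂ) * gk μ 0 y) atTop (𝓝 1) := by
    have h : Tendsto (fun y : ℝ => (1 : ℂ) + gk μ 1 y) atTop (𝓝 (1 + 0)) :=
      (tμ 1 (by norm_num)).const_add 1
    rw [add_zero] at h
    refine h.congr' ?_
    filter_upwards [eventually_gt_atTop 0] with y hy
    rw [gk_succ μ 0 (iμ 0 (by norm_num)) y hy, m0]; simp
  have hne : ∀ᶠ y : ℝ in atTop, gk μ 0 y ≠ 0 := by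
    filter_upwards [tz.eventually_ne one_ne_zero] with y hy h0
    exact hy (by rw [h0, mul_zero])
  have base : ∀ᶠ y : ℝ in atTop, gk μ 1 y = gk σ 0 y * gk μ 0 y := by
    filter_upwards [hne, eventually_gt_atTop 0] with y hy hy0
    have h1 := hF (I * y) (by simpa using hy0)
    have e1 : recip μ (I * y) = (gk μ 0 y)⁻¹ := by
      simp [recip, cauchy, gk]
    have e2 : ∫ u, ((u : ℂ) - I * y)⁻¹ ∂σ = - gk σ 0 y := by
      unfold gk
      rw [← integral_neg]
      congr 1; ext u
      rw [pow_zero, one_div, ← inv_neg, neg_sub]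
    rw [e1, e2] at h1
    have h2 := gk_succ μ 0 (iμ 0 (by norm_num)) y hy0
    rw [m0] at h2
    have h3 : (gk μ 0 y)⁻¹ * gk μ 0 y = 1 := inv_mul_cancel₀ hy
    rw [h1] at h3
    push_cast at h2
    linear_combination (-1 : ℂ) * h2 + h3
  have step : ∀ k : ℕ, k ≤ 7 → (∀ᶠ y : ℝ in atTop, gk μ (k + 1) y =
      ∑ i ∈ Finset.range k, (mom σ i : ℂ) * gk μ (k - 1 - i) y + gk σ k y * gk μ 0 y) →
      mom μ (k + 1) = ∑ i ∈ Finset.range k, mom σ i * mom μ (k - 1 - i) ∧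
      ∀ᶠ y : ℝ in atTop, (mom μ (k + 1) : ℂ) + gk μ (k + 2) y =
      ∑ i ∈ Finset.range k, (mom σ i : ℂ) * ((mom μ (k - 1 - i) : ℂ) + gk μ (k - i) y)
        + gk σ k y * (I * y * gk μ 0 y) := by
    intro k hk hP
    have hev : ∀ᶠ y : ℝ in atTop, (mom μ (k + 1) : ℂ) + gk μ (k + 2) y =
      ∑ i ∈ Finset.range k, (mom σ i : ℂ) * ((mom μ (k - 1 - i) : ℂ) + gk μ (k - i) y)
        + gk σ k y * (I * y * gk μ 0 y) := by
      filter_upwards [hP, eventually_gt_atTop 0] with y hy hy0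
      rw [← gk_succ μ (k + 1) (iμ _ (by omega)) y hy0, hy, mul_add, Finset.mul_sum]
      congr 1
      · refine Finset.sum_congr rfl fun i hi => ?_
        rw [Finset.mem_range] at hi
        have := gk_succ μ (k - 1 - i) (iμ _ (by omega)) y hy0
        rw [show k - 1 - i + 1 = k - i by omega] at this
        rw [← this]; ring
      · ring
    refine ⟨?_, hev⟩
    have l1 : Tendsto (fun y : ℝ => (mom μ (k + 1) : ℂ) + gk μ (k + 2) y) atTop
        (𝓝 ((mom μ (k + 1) : ℂ) + 0)) := (tμ (k + 2) (by omega)).const_add _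
    have l2 : Tendsto (fun y : ℝ => ∑ i ∈ Finset.range k, (mom σ i : ℂ) *
        ((mom μ (k - 1 - i) : ℂ) + gk μ (k - i) y) + gk σ k y * (I * y * gk μ 0 y)) atTop
        (𝓝 (∑ i ∈ Finset.range k, (mom σ i : ℂ) * ((mom μ (k - 1 - i) : ℂ) + 0) + 0 * 1)) := by
      refine Tendsto.add (tendsto_finsetSum _ fun i hi => ?_) ((tσ k hk).mul tz)
      exact ((tμ (k - i) (by omega)).const_add _).const_mul _
    have := tendsto_nhds_unique (l1.congr' hev) l2
    simp only [add_zero, zero_mul] at this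
    exact_mod_cast this
  have P : ∀ k : ℕ, k ≤ 7 → ∀ᶠ y : ℝ in atTop, gk μ (k + 1) y =
      ∑ i ∈ Finset.range k, (mom σ i : ℂ) * gk μ (k - 1 - i) y + gk σ k y * gk μ 0 y := by
    intro k
    induction k with
    | zero => intro _; simpa using base
    | succ k ih =>
      intro hk
      obtain ⟨hm, hev⟩ := step k (by omega) (ih (by omega))
      filter_upwards [hev, eventually_gt_atTop 0] with y hy hy0
      have hs := gk_succ σ k (iσ k (by omega)) y hy0
      rw [hm] at hy
      push_cast at hy
      simp only [mul_add, Finset.sum_add_distrib] at hy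
      rw [Finset.sum_range_succ]
      simp only [Nat.add_sub_cancel, Nat.sub_self]
      linear_combination hy + gk μ 0 y * hs
  exact fun k hk => (step k hk (P k hk)).1

lemma meas_bound (ν σ : Measure ℝ) [IsProbabilityMeasure ν] [IsFiniteMeasure σ]
    (hσ1 : σ.real univ ≤ 1) (L R : ℝ) (hσ : ∀ᵐ u ∂σ, |u| ≤ R) (hLR : 1 ≤ L - R) (hL : 2 ≤ L)
    (hF : ∀ z : ℂ, 0 < z.im → recip ν z = z + ∫ u, ((u : ℂ) - z)⁻¹ ∂σ)
    (x y : ℝ) (hx : L ≤ |x|) (hy : 0 < y) : ν.real (Icc (x - y) (x + y)) ≤ 4 * y ^ 2 := by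
  set z : ℂ := ⟨x, y⟩ with hz
  have hF := hF z hy
  have him : ∀ u : ℝ, ((z - (u : ℂ))⁻¹).im = - (y / ((x - u) ^ 2 + y ^ 2)) := by
    intro u
    rw [Complex.inv_im, Complex.normSq_apply]
    simp [hz]
    ring
  have intν : Integrable (fun u : ℝ => (z - (u : ℂ))⁻¹) ν := by
    refine Integrable.mono' (integrable_const (1 / y)) (by fun_prop)
      (Eventually.of_forall fun u => ?_)
    rw [norm_inv, one_div]
    have := Complex.abs_im_le_norm (z - (u : ℂ))
    simp [hz] at this
    have h2 := (le_abs_self y).trans this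
    gcongr
  have hGim : ν.real (Icc (x - y) (x + y)) / (2 * y) ≤ - (cauchy ν z).im := by
    have e : - (cauchy ν z).im = ∫ u, y / ((x - u) ^ 2 + y ^ 2) ∂ν := by
      rw [cauchy, show (∫ u, (z - (u : ℂ))⁻¹ ∂ν).im = ∫ u, ((z - (u : ℂ))⁻¹).im ∂ν from
        (integral_im intν).symm, ← integral_neg]
      simp [him]
    have hint : Integrable (fun u : ℝ => y / ((x - u) ^ 2 + y ^ 2)) ν := by
      have := intν.im.neg
      refine this.congr (Eventually.of_forall fun u => ?_)
      have := him u
      simp only [Pi.neg_apply]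
      change - ((z - (u : ℂ))⁻¹).im = _
      rw [this]; ring
    rw [e]
    have : ν.real (Icc (x - y) (x + y)) / (2 * y)
        = ∫ u, (Icc (x - y) (x + y)).indicator (fun _ => 1 / (2 * y)) u ∂ν := by
      rw [integral_indicator_const _ measurableSet_Icc]
      simp; ring
    rw [this]
    refine integral_mono ((integrable_const _).indicator measurableSet_Icc) hint fun u => ?_
    by_cases hu : u ∈ Icc (x - y) (x + y)
    · simp only [indicator_of_mem hu]
      rw [div_le_div_iff₀ (by positivity) (by positivity)]
      obtain ⟨h1, h2⟩ := hu
      nlinarith [mul_nonneg (sub_nonneg.2 h1) (sub_nonneg.2 h2)]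
    · simp only [indicator_of_notMem hu]
      positivity
  have hG : cauchy ν z = (z + ∫ u, ((u : ℂ) - z)⁻¹ ∂σ)⁻¹ := by
    rw [← hF, recip, inv_inv]
  have hxu : ∀ u : ℝ, |u| ≤ R → 1 ≤ |u - x| := by
    intro u hu
    have := abs_sub_abs_le_abs_sub x u
    rw [abs_sub_comm] at this
    linarith
  have hS : ‖∫ u, ((u : ℂ) - z)⁻¹ ∂σ‖ ≤ 1 := by
    have := norm_integral_le_of_norm_le_const (μ := σ) (f := fun u : ℝ => ((u : ℂ) - z)⁻¹) (C := 1) (by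
      filter_upwards [hσ] with u hu
      rw [norm_inv]
      refine inv_le_one_of_one_le₀ ?_
      have h1 := Complex.abs_re_le_norm ((u : ℂ) - z)
      simp [hz] at h1
      have := hxu u hu
      linarith)
    linarith
  have intσ : Integrable (fun u : ℝ => ((u : ℂ) - z)⁻¹) σ := by
    refine Integrable.mono' (integrable_const (1 / y)) (by fun_prop)
      (Eventually.of_forall fun u => ?_)
    rw [norm_inv, one_div]
    have := Complex.abs_im_le_norm ((u : ℂ) - z)
    simp [hz] at this
    have h2 := (le_abs_self y).trans this
    gcongr
  have hSim : (∫ u, ((u : ℂ) - z)⁻¹ ∂σ).im ≤ y := by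
    rw [show (∫ u, ((u : ℂ) - z)⁻¹ ∂σ).im = ∫ u, (((u : ℂ) - z)⁻¹).im ∂σ from
        (integral_im intσ).symm]
    have := norm_integral_le_of_norm_le_const (μ := σ)
      (f := fun u : ℝ => (((u : ℂ) - z)⁻¹).im) (C := y) (by
      filter_upwards [hσ] with u hu
      have h1 := hxu u hu
      have h2 : 1 ≤ (u - x) ^ 2 := by
        rw [← sq_abs]; nlinarith
      rw [Complex.inv_im, Complex.normSq_apply]
      simp [hz]
      rw [abs_of_pos hy,
        abs_of_pos (add_pos_of_nonneg_of_pos (mul_self_nonneg _) (mul_pos hy hy))]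
      refine div_le_self hy.le ?_
      nlinarith)
    have h3 := (le_abs_self _).trans this
    refine h3.trans ?_
    nlinarith
  set F : ℂ := z + ∫ u, ((u : ℂ) - z)⁻¹ ∂σ with hFd
  have hF1 : 1 ≤ ‖F‖ := by
    have h1 := norm_sub_le_norm_add z (∫ u, ((u : ℂ) - z)⁻¹ ∂σ)
    have h2 := Complex.abs_re_le_norm z
    have h3 : z.re = x := rfl
    rw [h3] at h2
    linarith
  have hFim : F.im ≤ 2 * y := by
    rw [hFd, Complex.add_im]
    have h3 : z.im = y := rfl
    rw [h3]; linarith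
  have hfin : - (cauchy ν z).im ≤ 2 * y := by
    rw [hG, Complex.inv_im, neg_div, neg_neg, Complex.normSq_eq_norm_sq]
    rw [div_le_iff₀ (by positivity)]
    nlinarith [mul_nonneg (sub_nonneg.2 hF1) (sub_nonneg.2 hF1)]
  have := hGim.trans hfin
  rw [div_le_iff₀ (by positivity)] at this
  linarith

lemma null_Icc (ν : Measure ℝ) [IsProbabilityMeasure ν] (a b : ℝ) (hab : a < b)
    (h : ∀ x ∈ Icc a b, ∀ y : ℝ, 0 < y → ν.real (Icc (x - y) (x + y)) ≤ 4 * y ^ 2) :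
    ν (Icc a b) = 0 := by
  have key : ∀ N : ℕ, ν.real (Icc a b) ≤ 8 * (b - a) ^ 2 / ((N : ℝ) + 1) := by
    intro N
    have hN : (0 : ℝ) < (N : ℝ) + 1 := by positivity
    set s : ℝ := (b - a) / ((N : ℝ) + 1) with hs
    have hs0 : 0 < s := div_pos (by linarith) hN
    have hsN : s * (N + 1) = b - a := by rw [hs]; field_simp
    have hsub : Icc a b ⊆ ⋃ i ∈ Finset.range (N + 2), Icc (a + i * s - s) (a + i * s + s) := by
      intro u hu
      simp only [mem_iUnion, Finset.mem_range]
      have h0 : 0 ≤ (u - a) / s := div_nonneg (by linarith [hu.1]) hs0.le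
      have f1 := Nat.floor_le h0
      have f2 := Nat.lt_floor_add_one ((u - a) / s)
      rw [le_div_iff₀ hs0] at f1
      rw [div_lt_iff₀ hs0] at f2
      refine ⟨⌊(u - a) / s⌋₊, ?_, ?_⟩
      · rw [Nat.lt_succ_iff]
        refine Nat.floor_le_of_le ?_
        rw [div_le_iff₀ hs0]
        push_cast
        linarith [hu.2]
      · constructor <;> linarith
    have h1 : ν.real (Icc a b) ≤ ∑ i ∈ Finset.range (N + 2), 4 * s ^ 2 := by
      refine (measureReal_mono hsub (measure_ne_top _ _)).trans
        ((measureReal_biUnion_finset_le _ _).trans (Finset.sum_le_sum fun i hi => ?_))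
      rw [Finset.mem_range] at hi
      refine h _ ⟨by nlinarith [mul_nonneg (Nat.cast_nonneg (α := ℝ) i) hs0.le], ?_⟩ s hs0
      have : (i : ℝ) ≤ N + 1 := by exact_mod_cast (by omega : i ≤ N + 1)
      nlinarith
    rw [Finset.sum_const, Finset.card_range, nsmul_eq_mul] at h1
    push_cast at h1
    rw [le_div_iff₀ hN, ← hsN]
    have hN0 : (0 : ℝ) ≤ N := by positivity
    have h2 : ((N : ℝ) + 2) * (4 * s ^ 2) ≤ 8 * (s ^ 2) * (N + 1) := by
      nlinarith [mul_nonneg hN0 (sq_nonneg s), sq_nonneg s]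
    nlinarith
  have lim : Tendsto (fun N : ℕ => 8 * (b - a) ^ 2 / ((N : ℝ) + 1)) atTop (𝓝 0) :=
    tendsto_const_nhds.div_atTop
      (tendsto_atTop_add_const_right _ _ tendsto_natCast_atTop_atTop)
  have h0 : ν.real (Icc a b) ≤ 0 := ge_of_tendsto' lim key
  have h00 : ν.real (Icc a b) = 0 := le_antisymm h0 measureReal_nonneg
  rwa [measureReal_eq_zero_iff] at h00

lemma supp_one (ν σ : Measure ℝ) [IsProbabilityMeasure ν] [IsFiniteMeasure σ]
    (hσ1 : σ.real univ ≤ 1) (L R : ℝ) (hσ : ∀ᵐ u ∂σ, |u| ≤ R) (hLR : 1 ≤ L - R) (hL : 2 ≤ L)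
    (hF : ∀ z : ℂ, 0 < z.im → recip ν z = z + ∫ u, ((u : ℂ) - z)⁻¹ ∂σ) :
    ν (Icc (-L) L) = 1 := by
  have hb := meas_bound ν σ hσ1 L R hσ hLR hL hF
  rw [← prob_compl_eq_zero_iff measurableSet_Icc]
  have hsub : (Icc (-L) L)ᶜ ⊆ ⋃ N : ℕ, (Icc L (L + (N + 1)) ∪ Icc (-L - (N + 1)) (-L)) := by
    intro u hu
    simp only [mem_compl_iff, mem_Icc, not_and_or, not_le] at hu
    obtain ⟨N, hN⟩ := exists_nat_ge (|u|)
    have h1 := (le_abs_self u).trans hN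
    have h2 := (neg_le_abs u).trans hN
    rw [mem_iUnion]
    refine ⟨N, ?_⟩
    rcases hu with hu | hu
    · right; constructor <;> linarith
    · left; constructor <;> linarith
  refine measure_mono_null hsub (measure_iUnion_null fun N => measure_union_null ?_ ?_)
  · have : (0 : ℝ) ≤ N := by positivity
    refine null_Icc ν _ _ (by linarith) fun x hx y hy => hb x y ?_ hy
    exact hx.1.trans (le_abs_self x)
  · have : (0 : ℝ) ≤ N := by positivity
    refine null_Icc ν _ _ (by linarith) fun x hx y hy => hb x y ?_ hy
    have := hx.2
    have := neg_le_abs x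
    linarith


lemma meas_trunc (n : ℕ) : MeasurableSet (truncSet n) :=
  measurableSet_le (by fun_prop) measurable_const

lemma compl_trunc (n : ℕ) :
    (truncSet n)ᶜ = {u : ℝ | Real.sqrt ((n : ℝ) - 1) / Real.pi < |u|} := by
  ext u; simp [truncSet]

lemma R_ge (n : ℕ) (hn : 2 ≤ n) : Real.sqrt n ≤ 5 * (Real.sqrt ((n : ℝ) - 1) / Real.pi) := by
  have hn' : (2 : ℝ) ≤ n := by exact_mod_cast hn
  have hp := Real.pi_lt_d2
  have hp0 := Real.pi_pos
  have h1 : Real.sqrt n * Real.pi ≤ 5 * Real.sqrt ((n : ℝ) - 1) := by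
    refine abs_le_of_sq_le_sq' ?_ (by positivity) |>.2
    rw [mul_pow, mul_pow, Real.sq_sqrt (by linarith), Real.sq_sqrt (by linarith)]
    have : Real.pi ^ 2 ≤ 10 := by nlinarith
    nlinarith
  rw [← mul_div_assoc, le_div_iff₀ hp0]
  exact h1

lemma tail_bound (τ : Measure ℝ) [IsProbabilityMeasure τ]
    (h6 : Integrable (fun u : ℝ => u ^ 6) τ) (n : ℕ) (hn : 2 ≤ n) (i : ℕ) (hi : i ≤ 6) :
    |mom τ i - mom (τ.restrict (truncSet n)) i| ≤
      (5 ^ 6 * mom τ 6) * (Real.sqrt n ^ (i + 2) / Real.sqrt n ^ 8) := by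
  have hint := int_pow_le τ 6 h6 i hi
  have hw : 0 < Real.sqrt n := Real.sqrt_pos.2 (by exact_mod_cast (by omega : 0 < n))
  have e : mom τ i - mom (τ.restrict (truncSet n)) i = ∫ u in (truncSet n)ᶜ, u ^ i ∂τ := by
    have := integral_add_compl (meas_trunc n) hint
    unfold mom
    linarith
  set w := Real.sqrt n with hwd
  rw [e]
  calc |∫ u in (truncSet n)ᶜ, u ^ i ∂τ| ≤ ∫ u in (truncSet n)ᶜ, |u ^ i| ∂τ :=
        abs_integral_le_integral_abs
    _ ≤ ∫ u in (truncSet n)ᶜ, (5 ^ 6 * (w ^ (i + 2) / w ^ 8)) * u ^ 6 ∂τ := by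
        refine setIntegral_mono_on hint.abs.integrableOn (h6.const_mul _).integrableOn
          (meas_trunc n).compl fun u hu => ?_
        rw [compl_trunc] at hu
        have hu' : w ≤ 5 * |u| := (R_ge n hn).trans (by
          have : Real.sqrt ((n : ℝ) - 1) / Real.pi < |u| := hu
          linarith)
        have h1 : w ^ (6 - i) ≤ (5 * |u|) ^ (6 - i) := by gcongr
        have h2 : w ^ (6 - i) * |u| ^ i ≤ 5 ^ 6 * |u| ^ 6 := by
          calc w ^ (6 - i) * |u| ^ i ≤ (5 * |u|) ^ (6 - i) * |u| ^ i := by gcongr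
            _ = 5 ^ (6 - i) * (|u| ^ (6 - i) * |u| ^ i) := by rw [mul_pow]; ring
            _ = 5 ^ (6 - i) * |u| ^ 6 := by rw [← pow_add, Nat.sub_add_cancel hi]
            _ ≤ 5 ^ 6 * |u| ^ 6 := by
              gcongr
              · norm_num
              · omega
        have h3 : w ^ 8 = w ^ (6 - i) * w ^ (i + 2) := by
          rw [← pow_add]; congr 1; omega
        have h4 : |u| ^ 6 = u ^ 6 := by
          rw [← abs_pow]; exact abs_of_nonneg (by positivity)
        rw [abs_pow, h3, ← h4]
        have h5 : w ^ (i + 2) / (w ^ (6 - i) * w ^ (i + 2)) = 1 / w ^ (6 - i) := by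
          field_simp
        rw [h5, mul_one_div, div_mul_eq_mul_div, le_div_iff₀ (by positivity)]
        linarith
    _ = (5 ^ 6 * (w ^ (i + 2) / w ^ 8)) * ∫ u in (truncSet n)ᶜ, u ^ 6 ∂τ := integral_const_mul _ _
    _ ≤ (5 ^ 6 * (w ^ (i + 2) / w ^ 8)) * mom τ 6 := by
        gcongr
        exact setIntegral_le_integral h6 (Eventually.of_forall fun u => by positivity)
    _ = _ := by ring

lemma rpow_conv (n : ℕ) (hn : 2 ≤ n) (j : ℕ) :
    (n : ℝ) ^ (-3 + ((j : ℝ) - 2) / 2) = Real.sqrt n ^ j / Real.sqrt n ^ 8 := by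
  have hw : 0 < Real.sqrt n := Real.sqrt_pos.2 (by exact_mod_cast (by omega : 0 < n))
  have hn2 : (n : ℝ) = Real.sqrt n ^ (2 : ℝ) := by
    rw [Real.rpow_two, Real.sq_sqrt (by positivity)]
  conv_lhs => rw [hn2]
  rw [← Real.rpow_mul hw.le, show 2 * (-3 + ((j : ℝ) - 2) / 2) = (j : ℝ) - (8 : ℕ) by push_cast; ring,
    Real.rpow_sub hw, Real.rpow_natCast, Real.rpow_natCast]

lemma rec_bound (t m : ℕ → ℝ) (s p : ℕ → ℕ → ℝ) (B T M : ℝ) (hB : 0 ≤ B) (hT : 0 ≤ T)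
    (hM : 0 ≤ M) (N : ℕ) (hN : 2 ≤ N)
    (hts : ∀ n, N ≤ n → ∀ i ≤ 6, |t i - s n i| ≤ B * (Real.sqrt n ^ (i + 2) / Real.sqrt n ^ 8))
    (hs : ∀ n, N ≤ n → ∀ i ≤ 6, |s n i| ≤ T) (hm : ∀ j ≤ 8, |m j| ≤ M)
    (h0 : ∀ n, m 0 = p n 0)
    (hr : ∀ k ≤ 7, m (k + 1) = ∑ i ∈ Finset.range k, t i * m (k - 1 - i))
    (hrp : ∀ n, N ≤ n → ∀ k ≤ 7, p n (k + 1) = ∑ i ∈ Finset.range k, s n i * p n (k - 1 - i)) :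
    ∀ J ≤ 8, ∃ C : ℝ, 0 ≤ C ∧ ∀ j ≤ J, ∀ n, N ≤ n →
      |m j - p n j| ≤ C * (Real.sqrt n ^ j / Real.sqrt n ^ 8) := by
  intro J
  induction J with
  | zero =>
    intro _
    refine ⟨0, le_rfl, fun j hj n _ => ?_⟩
    obtain rfl : j = 0 := by omega
    simp [h0 n]
  | succ k ih =>
    intro hk
    obtain ⟨C, hC, hCb⟩ := ih (by omega)
    refine ⟨C + k * (B * M + T * C), by positivity, fun j hj n hn => ?_⟩
    have hw1 : 1 ≤ Real.sqrt n := Real.one_le_sqrt.2 (by exact_mod_cast (by omega : 1 ≤ n))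
    have hw0 : 0 < Real.sqrt n := by linarith
    rcases Nat.lt_or_ge k j with hjk | hjk
    · obtain rfl : j = k + 1 := by omega
      rw [hr k (by omega), hrp n hn k (by omega), ← Finset.sum_sub_distrib]
      set w := Real.sqrt n
      have : |∑ i ∈ Finset.range k, (t i * m (k - 1 - i) - s n i * p n (k - 1 - i))|
          ≤ ∑ i ∈ Finset.range k, (B * M + T * C) * (w ^ (k + 1) / w ^ 8) := by
        refine (Finset.abs_sum_le_sum_abs _ _).trans (Finset.sum_le_sum fun i hi => ?_)
        rw [Finset.mem_range] at hi
        have e : t i * m (k - 1 - i) - s n i * p n (k - 1 - i) =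
          (t i - s n i) * m (k - 1 - i) + s n i * (m (k - 1 - i) - p n (k - 1 - i)) := by ring
        rw [e, add_mul]
        refine (abs_add_le _ _).trans (add_le_add ?_ ?_)
        · rw [abs_mul]
          calc _ ≤ (B * (w ^ (i + 2) / w ^ 8)) * M :=
                mul_le_mul (hts n hn i (by omega)) (hm _ (by omega)) (abs_nonneg _) (by positivity)
            _ ≤ (B * (w ^ (k + 1) / w ^ 8)) * M := by
                have : w ^ (i + 2) ≤ w ^ (k + 1) := pow_le_pow_right₀ hw1 (by omega)
                gcongr
            _ = _ := by ring
        · rw [abs_mul]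
          calc _ ≤ T * (C * (w ^ (k - 1 - i) / w ^ 8)) :=
                mul_le_mul (hs n hn i (by omega)) (hCb _ (by omega) n hn) (abs_nonneg _) hT
            _ ≤ T * (C * (w ^ (k + 1) / w ^ 8)) := by
                have : w ^ (k - 1 - i) ≤ w ^ (k + 1) := pow_le_pow_right₀ hw1 (by omega)
                gcongr
            _ = _ := by ring
      refine this.trans ?_
      rw [Finset.sum_const, Finset.card_range, nsmul_eq_mul, ← mul_assoc]
      gcongr
      linarith
    · refine (hCb j hjk n hn).trans ?_
      gcongr
      have : 0 ≤ (k : ℝ) * (B * M + T * C) := by positivity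
      linarith

lemma n_large : ∃ N : ℕ, ∀ n : ℕ, N ≤ n →
    1 ≤ Real.sqrt ((n : ℝ) - 1) / 3 - Real.sqrt ((n : ℝ) - 1) / Real.pi ∧
    2 ≤ Real.sqrt ((n : ℝ) - 1) / 3 := by
  refine ⟨40001, fun n hn => ?_⟩
  have hn' : (40001 : ℝ) ≤ n := by exact_mod_cast hn
  have h200 : 200 ≤ Real.sqrt ((n : ℝ) - 1) := Real.le_sqrt_of_sq_le (by linarith)
  have hp := Real.pi_gt_d2
  have h2 : Real.sqrt ((n : ℝ) - 1) / Real.pi ≤ Real.sqrt ((n : ℝ) - 1) / 3.14 := by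
    gcongr
  constructor
  · have : Real.sqrt ((n : ℝ) - 1) / 3 - Real.sqrt ((n : ℝ) - 1) / 3.14
      = Real.sqrt ((n : ℝ) - 1) * (1 / 3 - 1 / 3.14) := by ring
    have h3 : 200 * (1 / 3 - 1 / 3.14) ≤ Real.sqrt ((n : ℝ) - 1) * (1 / 3 - 1 / 3.14) := by
      gcongr
    norm_num at *
    linarith
  · linarith

theorem stmt_19
    (μ : Measure ℝ) [IsProbabilityMeasure μ]
    (h8 : Integrable (fun u => u ^ 8) μ)
    (h1 : mom μ 1 = 0) (h2 : mom μ 2 = 1)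
    (τ : Measure ℝ) [IsProbabilityMeasure τ]
    (hτ6 : Integrable (fun u => u ^ 6) τ)
    (hτ : ∀ z : ℂ, 0 < z.im → recip μ z = z + ∫ u, ((u : ℂ) - z)⁻¹ ∂τ)
    (μs : ℕ → Measure ℝ) (hμsP : ∀ n : ℕ, IsProbabilityMeasure (μs n))
    (hμs : ∀ n : ℕ, ∀ z : ℂ, 0 < z.im →
      recip (μs n) z = z + ∫ u in truncSet n, ((u : ℂ) - z)⁻¹ ∂τ) :
    ∃ c : ℝ, 0 < c ∧ ∃ n₁ : ℕ, ∀ n : ℕ, n₁ ≤ n →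
      (μs n) (Set.Icc (-(Real.sqrt ((n : ℝ) - 1) / 3)) (Real.sqrt ((n : ℝ) - 1) / 3)) = 1 ∧
      mom (μs n) 1 = 0 ∧
      mom μ 2 - mom (μs n) 2
          = (τ {u : ℝ | Real.sqrt ((n : ℝ) - 1) / Real.pi < |u|}).toReal ∧
      0 ≤ mom μ 2 - mom (μs n) 2 ∧
      mom μ 2 - mom (μs n) 2 ≤ c * (n : ℝ) ^ (-(3 : ℝ)) ∧
      ∀ j : ℕ, 3 ≤ j → j ≤ 8 →
        |mom μ j - mom (μs n) j| ≤ c * (n : ℝ) ^ (-3 + ((j : ℝ) - 2) / 2) := by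
  obtain ⟨N₀, hN₀⟩ := n_large
  set N := max N₀ 2 with hN
  have hN2 : ∀ n, N ≤ n → 2 ≤ n := fun n h => (le_max_right _ _).trans h
  set σ : ℕ → Measure ℝ := fun n => τ.restrict (truncSet n) with hσ
  have hreal : ∀ n, (σ n).real univ ≤ 1 := fun n => by
    simp only [hσ, measureReal_restrict_apply MeasurableSet.univ]
    exact measureReal_le_one
  have supp : ∀ n, N ≤ n → (μs n)
      (Set.Icc (-(Real.sqrt ((n : ℝ) - 1) / 3)) (Real.sqrt ((n : ℝ) - 1) / 3)) = 1 := by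
    intro n hn
    obtain ⟨a1, a2⟩ := hN₀ n ((le_max_left _ _).trans hn)
    exact supp_one (μs n) (σ n) (hreal n) _ (Real.sqrt ((n : ℝ) - 1) / Real.pi)
      (ae_restrict_of_forall_mem (meas_trunc n) fun u hu => hu) a1 a2 (hμs n)
  have int8 : ∀ n, N ≤ n → Integrable (fun u : ℝ => u ^ 8) (μs n) := by
    intro n hn
    have hs := supp n hn
    have hae : ∀ᵐ u ∂(μs n), u ∈ Set.Icc (-(Real.sqrt ((n : ℝ) - 1) / 3))
        (Real.sqrt ((n : ℝ) - 1) / 3) := (prob_compl_eq_zero_iff measurableSet_Icc).2 hs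
    refine Integrable.mono' (integrable_const ((Real.sqrt ((n : ℝ) - 1) / 3) ^ 8))
      (by fun_prop) ?_
    filter_upwards [hae] with u hu
    rw [norm_pow, Real.norm_eq_abs]
    have := abs_le.2 hu
    gcongr
  have recμ := mom_rec μ τ h8 hτ6 hτ
  have recs : ∀ n, N ≤ n → _ := fun n hn =>
    mom_rec (μs n) (σ n) (int8 n hn) hτ6.restrict (hμs n)
  have iτ := int_pow_le τ 6 hτ6
  have hsT : ∀ n, N ≤ n → ∀ i ≤ 6, |mom (σ n) i| ≤ ∑ i ∈ Finset.range 7, ∫ u, |u ^ i| ∂τ := by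
    intro n _ i hi
    have h1 : |mom (σ n) i| ≤ ∫ u, |u ^ i| ∂τ := by
      unfold mom
      refine abs_integral_le_integral_abs.trans ?_
      exact setIntegral_le_integral (iτ i hi).abs (Eventually.of_forall fun u => abs_nonneg _)
    refine h1.trans (Finset.single_le_sum (f := fun i : ℕ => ∫ u, |u ^ i| ∂τ) (fun i _ => integral_nonneg fun u => abs_nonneg _)
      (Finset.mem_range.2 (by omega)))
  have hmM : ∀ j ≤ 8, |mom μ j| ≤ ∑ j ∈ Finset.range 9, |mom μ j| := by
    intro j hj
    exact Finset.single_le_sum (f := fun j => |mom μ j|) (fun i _ => abs_nonneg _)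
      (Finset.mem_range.2 (by omega))
  have hA : 0 ≤ mom τ 6 := integral_nonneg fun u => by positivity
  obtain ⟨C, hC, hCb⟩ := rec_bound (mom τ) (mom μ) (fun n => mom (σ n)) (fun n => mom (μs n))
    (5 ^ 6 * mom τ 6) _ _ (by positivity)
    (Finset.sum_nonneg fun i _ => integral_nonneg fun u => abs_nonneg _)
    (Finset.sum_nonneg fun i _ => abs_nonneg _) N (le_max_right _ _)
    (fun n hn i hi => tail_bound τ hτ6 n (hN2 n hn) i hi) hsT hmM
    (fun n => by simp [mom]) recμ recs 8 le_rfl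
  have hbd : ∀ n, N ≤ n → ∀ j ≤ 8, |mom μ j - mom (μs n) j| ≤
      (C + 1) * (n : ℝ) ^ (-3 + ((j : ℝ) - 2) / 2) := by
    intro n hn j hj
    rw [rpow_conv n (hN2 n hn)]
    refine (hCb j hj n hn).trans ?_
    gcongr
    linarith
  refine ⟨C + 1, by linarith, N, fun n hn => ?_⟩
  have e2 : mom μ 2 - mom (μs n) 2
      = (τ {u : ℝ | Real.sqrt ((n : ℝ) - 1) / Real.pi < |u|}).toReal := by
    have r2 := recs n hn 1 (by norm_num)
    have m0 : mom (μs n) 0 = 1 := by simp [mom]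
    have s0 : mom (σ n) 0 = τ.real (truncSet n) := by simp [mom, hσ]
    simp only [Finset.sum_range_one, m0, s0, mul_one] at r2
    norm_num [m0] at r2
    rw [h2, r2, ← compl_trunc]
    exact (probReal_compl_eq_one_sub (meas_trunc n)).symm
  refine ⟨supp n hn, ?_, e2, ?_, ?_, fun j _ hj => hbd n hn j hj⟩
  · simpa using recs n hn 0 (by norm_num)
  · rw [e2]; exact ENNReal.toReal_nonneg
  · have := hbd n hn 2 (by norm_num)
    norm_num at this
    have := (le_abs_self _).trans this
    simpa using this

end FreeCLT
end
end
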